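/- arXiv:1412.3931 — 6 statements merged into one kernel-verified Lean document; each statement's English description precedes it below -/
import Mathlib

section
/- The Meixner polynomials M_n(x;α,κ), defined by Σ_{n≥0} (Γ(α+n)/(Γ(α) n!)) M_n(x;α,κ) z^n = (1 - z/κ)^x (1-z)^{-(x+α)}, satisfy E[M_m(X;α,κ) M_n(X;α,κ)] = δ_{mn} Γ(α) n! / (Γ(α+n) κ^n) when X has a negative binomial distribution with parameters α, θ and κ = θ/(1+θ). -/
open Filter Topology

/-- Two real power series with the same sum on a neighbourhood of `0` have equal coefficients. -/
lemma coeff_eq_of_hasSum {a b : ℕ → ℝ} {f : ℝ → ℝ} {r : ℝ} (hr : 0 < r)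
    (ha : ∀ z : ℝ, |z| < r → HasSum (fun n => a n * z ^ n) (f z))
    (hb : ∀ z : ℝ, |z| < r → HasSum (fun n => b n * z ^ n) (f z)) (n : ℕ) : a n = b n := by
  have key : ∀ c : ℕ → ℝ, (∀ z : ℝ, |z| < r → HasSum (fun n => c n * z ^ n) (f z)) →
      HasFPowerSeriesAt f (FormalMultilinearSeries.ofScalars ℝ c) 0 := by
    intro c hc
    rw [hasFPowerSeriesAt_iff]
    have : ∀ᶠ z : ℝ in 𝓝 0, |z| < r := by
      have : Tendsto (fun z : ℝ => |z|) (𝓝 0) (𝓝 |0|) := continuous_abs.tendsto 0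
      exact this.eventually (by simpa using gt_mem_nhds hr)
    filter_upwards [this] with z hz
    simpa [FormalMultilinearSeries.coeff_ofScalars, mul_comm] using hc z hz
  have h := (key a ha).eq_formalMultilinearSeries (key b hb)
  simpa [FormalMultilinearSeries.coeff_ofScalars] using
    congrArg (fun p : FormalMultilinearSeries ℝ ℝ ℝ => p.coeff n) h

/-- Multiplying a power series by `1 - d * z`. -/
lemma hasSum_one_sub_mul {a : ℕ → ℝ} {z s : ℝ} (d : ℝ) (h : HasSum (fun n => a n * z ^ n) s) :
    HasSum (fun n => (a n - d * if n = 0 then 0 else a (n - 1)) * z ^ n) ((1 - d * z) * s) := by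
  have h' : HasSum (fun n => (if n = 0 then 0 else a (n - 1)) * z ^ n) (z * s) := by
    rw [← hasSum_nat_add_iff' 1]
    convert! h.mul_left z using 1
    · ext n
      simp [pow_succ]
      ring
    · simp
  convert! h.sub (h'.mul_left d) using 1
  · ext n
    ring
  · ring

lemma gamma_add_nat_eq_ascPochhammer {α : ℝ} (hα : 0 < α) (n : ℕ) :
    Real.Gamma (α + n) = Real.Gamma α * (ascPochhammer ℝ n).eval α := by
  induction n with
  | zero => simp
  | succ n ih =>
    rw [Nat.cast_succ, ← add_assoc, Real.Gamma_add_one (by positivity), ih,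
      ascPochhammer_succ_eval]
    ring

/-- The negative binomial series. -/
lemma hasSum_negative_binomial {α z : ℝ} (hα : 0 < α) (hz : |z| < 1) :
    HasSum (fun n : ℕ => Real.Gamma (α + n) / (Real.Gamma α * n.factorial) * z ^ n)
      ((1 - z) ^ (-α)) := by
  have h := (Real.one_div_one_sub_rpow_hasFPowerSeriesOnBall_zero α).hasSum (y := z)
    (by simpa [enorm_eq_nnnorm, ← NNReal.coe_lt_coe] using hz)
  have hz' : 0 < 1 - z := by linarith [(abs_lt.mp hz).2]
  convert! h using 1
  · ext n
    have hf : (n.factorial : ℝ) ≠ 0 := by positivity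
    have hG := (Real.Gamma_pos_of_pos hα).ne'
    have := Ring.factorial_nsmul_multichoose_eq_ascPochhammer α n
    rw [Polynomial.ascPochhammer_smeval_eq_eval, Ring.multichoose_eq, nsmul_eq_mul] at this
    simp only [FormalMultilinearSeries.ofScalars_apply_eq, smul_eq_mul,
      gamma_add_nat_eq_ascPochhammer hα, ← this]
    field_simp
  · simp [Real.rpow_neg hz'.le]

/-- Interchanging a power series with a weighted sum, under an absolute bound. -/
lemma hasSum_tsum_mul_pow {Q : ℕ → ℕ → ℝ} {S G u : ℕ → ℝ} {z ρ : ℝ} (hz : |z| ≤ ρ)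
    (hS : ∀ x, HasSum (fun n => |Q n x| * ρ ^ n) (S x))
    (hG : ∀ x, HasSum (fun n => Q n x * z ^ n) (G x))
    (hu : Summable fun x => |u x| * S x) :
    HasSum (fun n => (∑' x, u x * Q n x) * z ^ n) (∑' x, u x * G x) := by
  have hρ : 0 ≤ ρ := (abs_nonneg z).trans hz
  have hbd : Summable fun p : ℕ × ℕ => |u p.1| * (|Q p.2 p.1| * ρ ^ p.2) := by
    have h0 : 0 ≤ fun p : ℕ × ℕ => |u p.1| * (|Q p.2 p.1| * ρ ^ p.2) := fun p => by
      simp only [Pi.zero_apply]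
      positivity
    refine (summable_prod_of_nonneg h0).2 ⟨fun x => ?_, ?_⟩
    · exact Summable.mul_left |u x| (hS x).summable
    · simpa only [tsum_mul_left, (hS _).tsum_eq] using hu
  have hsum : Summable fun p : ℕ × ℕ => u p.1 * (Q p.2 p.1 * z ^ p.2) := by
    refine .of_norm_bounded hbd fun p => ?_
    rw [Real.norm_eq_abs, abs_mul, abs_mul, abs_pow]
    gcongr
  have h1 := hsum.hasSum.prod_fiberwise fun x => (hG x).mul_left (u x)
  have h2 := (Equiv.prodComm ℕ ℕ).hasSum_iff.mpr hsum.hasSum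
  have h3 := h2.prod_fiberwise fun n => (hsum.prod_symm.prod_factor n).hasSum
  rw [h1.tsum_eq]
  convert! h3 using 2 with n
  rw [← tsum_mul_right]
  exact tsum_congr fun x => by simp [mul_assoc]

/-- If the generating function of `Q · x` is `g z * ((1 - z / c) / (1 - z)) ^ x`, then its
absolute generating function grows at most geometrically in `x`. -/
lemma tsum_abs_mul_pow_le {Q : ℕ → ℕ → ℝ} {g : ℝ → ℝ} {c r ρ : ℝ} (hc : 0 < c) (hr : r ≤ 1)
    (hρ : 0 < ρ) (hρr : ρ < r)
    (hQ : ∀ (x : ℕ) (z : ℝ), |z| < r →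
      HasSum (fun n => Q n x * z ^ n) (((1 - z / c) / (1 - z)) ^ x * g z)) (x : ℕ) :
    ∑' n, |Q n x| * ρ ^ n ≤
      ((1 + ρ / c) / (1 - ρ)) ^ x * ∑' n, |Q n 0| * ρ ^ n := by
  have hS : ∀ x, Summable fun n => |Q n x| * ρ ^ n := fun x => by
    simpa [abs_mul, abs_of_pos hρ] using
      (hQ x ρ (by rwa [abs_of_pos hρ])).summable.abs
  have hrec : ∀ x n, Q n (x + 1) - 1 * (if n = 0 then 0 else Q (n - 1) (x + 1)) =
      Q n x - 1 / c * (if n = 0 then 0 else Q (n - 1) x) := by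
    intro x
    refine coeff_eq_of_hasSum (hρ.trans hρr)
      (fun z hz => hasSum_one_sub_mul 1 (hQ (x + 1) z hz)) fun z hz => ?_
    have : 1 - z ≠ 0 := by linarith [(abs_lt.mp hz).2]
    convert! hasSum_one_sub_mul (1 / c) (hQ x z hz) using 1
    rw [pow_succ]
    field_simp
  have hstep : ∀ x, ∑' n, |Q n (x + 1)| * ρ ^ n ≤
      (1 + ρ / c) / (1 - ρ) * ∑' n, |Q n x| * ρ ^ n := by
    intro x
    have h1 := (hS (x + 1)).tsum_eq_zero_add
    have h0 := (hS x).tsum_eq_zero_add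
    have hQ0 : Q 0 (x + 1) = Q 0 x := by simpa using hrec x 0
    have hle : ∑' n, |Q (n + 1) (x + 1)| * ρ ^ (n + 1) ≤
        ∑' n, (ρ * (|Q n (x + 1)| * ρ ^ n) + |Q (n + 1) x| * ρ ^ (n + 1) +
          ρ / c * (|Q n x| * ρ ^ n)) := by
      refine Summable.tsum_le_tsum (fun n => ?_) ((summable_nat_add_iff 1).2 (hS (x + 1)))
        ((((hS (x + 1)).mul_left ρ).add ((summable_nat_add_iff 1).2 (hS x))).add
          ((hS x).mul_left _))
      have h := hrec x (n + 1)
      simp only [Nat.succ_ne_zero, if_false, Nat.add_sub_cancel] at h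
      have h' : Q (n + 1) (x + 1) = Q n (x + 1) + Q (n + 1) x + -(1 / c * Q n x) := by linarith
      have habs : |Q (n + 1) (x + 1)| ≤ |Q n (x + 1)| + |Q (n + 1) x| + 1 / c * |Q n x| := by
        rw [h']
        refine (abs_add_three _ _ _).trans_eq ?_
        rw [abs_neg, abs_mul, abs_of_pos (by positivity : 0 < 1 / c)]
      refine (mul_le_mul_of_nonneg_right habs (by positivity)).trans_eq ?_
      ring
    rw [Summable.tsum_add (((hS (x + 1)).mul_left ρ).add ((summable_nat_add_iff 1).2 (hS x)))
      ((hS x).mul_left _), Summable.tsum_add ((hS (x + 1)).mul_left ρ)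
      ((summable_nat_add_iff 1).2 (hS x)), tsum_mul_left, tsum_mul_left] at hle
    rw [hQ0] at h1
    rw [div_mul_eq_mul_div, le_div_iff₀ (by linarith)]
    linarith
  induction x with
  | zero => simp
  | succ x ih =>
    refine (hstep x).trans ?_
    rw [pow_succ', mul_assoc]
    have : 0 < 1 - ρ := by linarith
    gcongr

/-- A radius on which the geometric growth of the generating functions beats the weight. -/
lemma exists_radius {c : ℝ} (hc : 0 < c) (hc1 : c < 1) :
    ∃ ρ : ℝ, 0 < ρ ∧ ρ < min 1 c ∧ c * ((1 + ρ / c) / (1 - ρ)) ^ 2 < 1 := by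
  have h1 : ∀ᶠ ρ : ℝ in 𝓝[>] 0, c * ((1 + ρ / c) / (1 - ρ)) ^ 2 < 1 := by
    have : ContinuousAt (fun ρ : ℝ => c * ((1 + ρ / c) / (1 - ρ)) ^ 2) 0 := by
      have : (1 : ℝ) - 0 ≠ 0 := by norm_num
      fun_prop (disch := assumption)
    exact (this.tendsto.mono_left nhdsWithin_le_nhds).eventually (gt_mem_nhds (by simpa using hc1))
  have h2 : ∀ᶠ ρ : ℝ in 𝓝[>] 0, ρ < min 1 c :=
    nhdsWithin_le_nhds (gt_mem_nhds (lt_min one_pos hc))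
  obtain ⟨ρ, h, h', hρ⟩ := (h1.and (h2.and self_mem_nhdsWithin)).exists
  exact ⟨ρ, hρ, h', h⟩

/-- Orthogonality for the coefficients of `((1 - z / c) / (1 - z)) ^ x * (1 - z) ^ (-α)`. -/
lemma tsum_weight_mul_coeff_mul_coeff {α c : ℝ} (hα : 0 < α) (hc : 0 < c) (hc1 : c < 1)
    {Q : ℕ → ℕ → ℝ}
    (hQ : ∀ (x : ℕ) (z : ℝ), |z| < min 1 c →
      HasSum (fun n => Q n x * z ^ n) (((1 - z / c) / (1 - z)) ^ x * (1 - z) ^ (-α))) (m n : ℕ) :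
    ∑' x : ℕ, Real.Gamma (α + x) / (Real.Gamma α * x.factorial) * c ^ x * (1 - c) ^ α *
        (Q m x * Q n x) =
      if m = n then Real.Gamma (α + n) / (Real.Gamma α * n.factorial) * (1 / c) ^ n else 0 := by
  obtain ⟨ρ, hρ, hρr, hB⟩ := exists_radius hc hc1
  have hρ1 : ρ < 1 := hρr.trans_le (min_le_left _ _)
  set B : ℝ := (1 + ρ / c) / (1 - ρ)
  have hB0 : 0 < B := div_pos (by positivity) (by linarith)
  set q : ℝ → ℝ := fun z => (1 - z / c) / (1 - z)
  have hq : ∀ z, |z| ≤ ρ → |q z| ≤ B := by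
    intro z hz
    have h1 : 1 - ρ ≤ |1 - z| := by
      linarith [le_abs_self (1 - z), (abs_le.mp hz).2]
    have h2 : |1 - z / c| ≤ 1 + ρ / c := by
      refine (abs_sub _ _).trans ?_
      rw [abs_one, abs_div, abs_of_pos hc]
      gcongr
    have : 0 < 1 - ρ := by linarith
    rw [abs_div]
    exact div_le_div₀ (by positivity) h2 this h1
  set b : ℕ → ℝ := fun n => Real.Gamma (α + n) / (Real.Gamma α * n.factorial) with hb
  have hb0 : ∀ n, 0 ≤ b n := fun n =>
    div_nonneg (Real.Gamma_pos_of_pos (by positivity)).le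
      (mul_pos (Real.Gamma_pos_of_pos hα) (by positivity)).le
  have hnb : ∀ z : ℝ, |z| < 1 → HasSum (fun n => b n * z ^ n) ((1 - z) ^ (-α)) :=
    fun z hz => hasSum_negative_binomial hα hz
  set K : ℝ := (1 - c) ^ α with hK
  have hK0 : 0 < K := Real.rpow_pos_of_pos (by linarith) _
  set w : ℕ → ℝ := fun x => b x * c ^ x * K with hw
  have hw0 : ∀ x, 0 ≤ w x := fun x =>
    mul_nonneg (mul_nonneg (hb0 x) (by positivity)) hK0.le
  set S : ℕ → ℝ := fun x => ∑' n, |Q n x| * ρ ^ n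
  have hS0 : ∀ x, 0 ≤ S x := fun x => tsum_nonneg fun n => by positivity
  have hS : ∀ x, HasSum (fun n => |Q n x| * ρ ^ n) (S x) := fun x => by
    refine Summable.hasSum ?_
    simpa [abs_mul, abs_of_pos hρ] using (hQ x ρ (by rwa [abs_of_pos hρ])).summable.abs
  have hSB : ∀ x, S x ≤ B ^ x * S 0 := fun x =>
    tsum_abs_mul_pow_le (g := fun z => (1 - z) ^ (-α)) hc (min_le_left _ _) hρ hρr hQ x
  have hwS : Summable fun x => w x * (S x * S x) := by
    have hs := ((hnb (c * B ^ 2) (by rwa [abs_of_pos (by positivity)])).summable).mul_left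
      (K * (S 0 * S 0))
    refine hs.of_nonneg_of_le (fun x => mul_nonneg (hw0 x) (mul_self_nonneg _)) fun x => ?_
    calc w x * (S x * S x) ≤ w x * ((B ^ x * S 0) * (B ^ x * S 0)) := by
          refine mul_le_mul_of_nonneg_left ?_ (hw0 x)
          exact mul_self_le_mul_self (hS0 x) (hSB x)
      _ = _ := by
          simp only [hw, mul_pow, ← pow_mul]
          ring
  have hwS' : ∀ {v : ℕ → ℝ} (C : ℝ), (∀ x, |v x| ≤ C * S x) →
      Summable fun x => |w x * v x| * S x := by
    intro v C hv
    refine (hwS.mul_left C).of_nonneg_of_le (fun x => mul_nonneg (abs_nonneg _) (hS0 x)) fun x => ?_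
    rw [abs_mul, abs_of_nonneg (hw0 x)]
    calc w x * |v x| * S x ≤ w x * (C * S x) * S x := by
          exact mul_le_mul_of_nonneg_right (mul_le_mul_of_nonneg_left (hv x) (hw0 x)) (hS0 x)
      _ = _ := by ring
  set G : ℕ → ℝ → ℝ := fun x z => q z ^ x * (1 - z) ^ (-α) with hG
  have hQ' : ∀ z, |z| ≤ ρ → ∀ x, HasSum (fun n => Q n x * z ^ n) (G x z) :=
    fun z hz x => hQ x z (hz.trans_lt hρr)
  have hGS : ∀ z, |z| ≤ ρ → ∀ x, |G x z| ≤ 1 * S x := by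
    intro z hz x
    rw [one_mul, ← (hQ' z hz x).tsum_eq, ← Real.norm_eq_abs]
    refine tsum_of_norm_bounded (hS x) fun n => ?_
    rw [Real.norm_eq_abs, abs_mul, abs_pow]
    gcongr
  have hQS : ∀ m x, |Q m x| ≤ (ρ ^ m)⁻¹ * S x := by
    intro m x
    rw [inv_mul_eq_div, le_div_iff₀ (by positivity)]
    exact le_hasSum (hS x) m fun j _ => by positivity
  have hclosed : ∀ z y : ℝ, |z| ≤ ρ → |y| ≤ ρ →
      ∑' x, w x * G x z * G x y = (1 - z * y / c) ^ (-α) := by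
    intro z y hz hy
    have hz1 : 0 < 1 - z := by linarith [(abs_le.mp hz).2]
    have hy1 : 0 < 1 - y := by linarith [(abs_le.mp hy).2]
    have hcq : |c * (q z * q y)| < 1 := by
      rw [abs_mul, abs_mul, abs_of_pos hc]
      refine lt_of_le_of_lt ?_ hB
      rw [sq]
      gcongr
      · exact hq z hz
      · exact hq y hy
    have h1 : 0 < 1 - c * (q z * q y) := by linarith [(abs_lt.mp hcq).2]
    have h := (hnb _ hcq).mul_left (K * (1 - z) ^ (-α) * (1 - y) ^ (-α))
    have hc1' : 0 < 1 - c := by linarith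
    have hKinv : K = ((1 - c)⁻¹) ^ (-α) := by
      rw [hK, Real.inv_rpow hc1'.le, Real.rpow_neg hc1'.le, inv_inv]
    have hprod : 1 - z * y / c = (1 - c)⁻¹ * (1 - z) * (1 - y) * (1 - c * (q z * q y)) := by
      simp only [q]
      field_simp
      ring
    rw [hprod, Real.mul_rpow (by positivity) h1.le, Real.mul_rpow (by positivity) hy1.le,
      Real.mul_rpow (by positivity) hz1.le, ← hKinv, ← h.tsum_eq]
    refine tsum_congr fun x => ?_
    simp only [hw, hG, mul_pow]
    ring
  have hinner : ∀ m z, |z| < ρ → ∑' x, w x * G x z * Q m x = b m * (z / c) ^ m := by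
    intro m z hz
    refine coeff_eq_of_hasSum (a := fun m => ∑' x, w x * G x z * Q m x)
      (b := fun m => b m * (z / c) ^ m) (f := fun y => ∑' x, w x * G x z * G x y) hρ
      (fun y hy => ?_) (fun y hy => ?_) m
    · exact hasSum_tsum_mul_pow hy.le hS (hQ' y hy.le) (hwS' 1 (hGS z hz.le))
    · rw [hclosed z y hz.le hy.le]
      have hzy : |z * y / c| < 1 := by
        rw [abs_div, abs_mul, abs_of_pos hc, div_lt_one hc]
        have hρc := hρr.trans_le (min_le_right 1 c)
        nlinarith [abs_nonneg z, abs_nonneg y]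
      convert! hnb _ hzy using 2 with k
      rw [mul_assoc, ← mul_pow]
      ring
  have hmain := coeff_eq_of_hasSum (a := fun n => ∑' x, w x * Q m x * Q n x)
    (b := fun n => if n = m then b m * (1 / c) ^ m else 0)
    (f := fun z => ∑' x, w x * Q m x * G x z) hρ
    (fun z hz => hasSum_tsum_mul_pow hz.le hS (hQ' z hz.le) (hwS' _ (hQS m)))
    (fun z hz => by
      have h1 : ∑' x, w x * Q m x * G x z = b m * (1 / c) ^ m * z ^ m := by
        rw [mul_assoc, ← mul_pow, one_div_mul_eq_div, ← hinner m z hz]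
        exact tsum_congr fun x => by ring
      rw [h1]
      convert! hasSum_ite_eq m (b m * (1 / c) ^ m * z ^ m) using 2 with k
      split_ifs with h
      · rw [h]
      · simp) n
  simp only [mul_assoc] at hmain ⊢
  simp only [hw, hb, mul_assoc] at hmain
  rw [hmain]
  by_cases h : m = n
  · simp [h]
  · simp [h, Ne.symm h]

/-- Orthogonality of the Meixner polynomials `M_n(x;α,κ)` with `κ = θ/(1+θ)`,
defined by the generating function
`Σ_{n≥0} (Γ(α+n)/(Γ(α) n!)) M_n(x;α,κ) z^n = (1 - z/κ)^x (1-z)^{-(x+α)}`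
for `|z| < min(1,κ)`, with respect to the negative binomial distribution
`P(X = x) = (Γ(α+x)/(Γ(α) x!)) θ^x/(1+θ)^{x+α}`:
`E[M_m M_n] = δ_{mn} Γ(α) n! / (Γ(α+n) κ^n)`. -/
theorem meixner_orthogonality
    (α θ : ℝ) (hα : 0 < α) (hθ : 0 < θ) (M : ℕ → ℕ → ℝ)
    (hgen : ∀ (x : ℕ) (z : ℝ), |z| < min 1 (θ / (1 + θ)) →
      HasSum (fun n : ℕ =>
          Real.Gamma (α + n) / (Real.Gamma α * n.factorial) * M n x * z ^ n)
        ((1 - z / (θ / (1 + θ))) ^ x * (1 - z) ^ (-((x : ℝ) + α)))) :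
    ∀ m n : ℕ,
      (∑' x : ℕ, Real.Gamma (α + x) / (Real.Gamma α * x.factorial)
          * θ ^ x / (1 + θ) ^ ((x : ℝ) + α) * (M m x * M n x))
        = if m = n then
            Real.Gamma α * n.factorial / (Real.Gamma (α + n) * (θ / (1 + θ)) ^ n)
          else 0 := by
  have h1θ : 0 < 1 + θ := by positivity
  set c : ℝ := θ / (1 + θ) with hc
  have hc0 : 0 < c := by positivity
  have hc1 : c < 1 := by
    rw [hc, div_lt_one h1θ]
    linarith
  have hcθ : 1 - c = (1 + θ)⁻¹ := by
    rw [hc]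
    field_simp
    ring
  intro m n
  have hΓ : ∀ k : ℕ, Real.Gamma (α + k) ≠ 0 := fun k =>
    (Real.Gamma_pos_of_pos (by positivity)).ne'
  have hΓα : Real.Gamma α ≠ 0 := (Real.Gamma_pos_of_pos hα).ne'
  have hb0 : ∀ k : ℕ, Real.Gamma (α + k) / (Real.Gamma α * k.factorial) ≠ 0 := fun k =>
    div_ne_zero (hΓ k) (mul_ne_zero hΓα (by positivity))
  have key := tsum_weight_mul_coeff_mul_coeff hα hc0 hc1
    (Q := fun n x => Real.Gamma (α + n) / (Real.Gamma α * n.factorial) * M n x)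
    (fun x z hz => by
      have hz1 : 0 < 1 - z := by
        linarith [(abs_lt.mp (hz.trans_le (min_le_left _ _))).2]
      convert! hgen x z hz using 1
      rw [neg_add, Real.rpow_add hz1, Real.rpow_neg hz1.le (x : ℝ), Real.rpow_natCast, div_pow]
      ring) m n
  have hsum : (∑' x : ℕ, Real.Gamma (α + x) / (Real.Gamma α * x.factorial)
      * θ ^ x / (1 + θ) ^ ((x : ℝ) + α) * (M m x * M n x)) *
      (Real.Gamma (α + m) / (Real.Gamma α * m.factorial) *
        (Real.Gamma (α + n) / (Real.Gamma α * n.factorial))) =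
      if m = n then Real.Gamma (α + n) / (Real.Gamma α * n.factorial) * (1 / c) ^ n else 0 := by
    rw [← key, ← tsum_mul_right]
    refine tsum_congr fun x => ?_
    rw [hcθ, Real.inv_rpow h1θ.le, Real.rpow_add h1θ, Real.rpow_natCast, hc, div_pow]
    ring
  rw [← eq_div_iff (mul_ne_zero (hb0 m) (hb0 n))] at hsum
  rw [hsum]
  split_ifs with h
  · subst h
    have := hΓ m
    rw [one_div, inv_pow]
    field_simp
  · simp
end

section
/- If Z_1,…,Z_N are i.i.d. on {1,…,d} with P(Z = k) = p_k, and X_i = #{k : Z_k = i}, then the multivariate Krawtchouk polynomial admits the symmetrized representation Q_n(X;u) = Σ_{{A_l}} Π_{k ∈ A_1} u^{(1)}_{Z_k} ⋯ Π_{k ∈ A_{d-1}} u^{(d-1)}_{Z_k}, where the sum is over all families of disjoint subsets A_1,…,A_{d-1} of {1,…,N} with |A_l| = n_l. -/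
/-- A power series in one real variable converging to `0` everywhere has zero coefficients. -/
theorem eq_zero_of_hasSum_mul_pow_zero {c : ℕ → ℝ}
    (h : ∀ t : ℝ, HasSum (fun n => c n * t ^ n) 0) : c = 0 := by
  have hp : HasFPowerSeriesAt (fun _ : ℝ => (0 : ℝ))
      (FormalMultilinearSeries.ofScalars ℝ c) 0 := by
    rw [hasFPowerSeriesAt_iff]
    refine Filter.Eventually.of_forall fun t => ?_
    simpa [FormalMultilinearSeries.coeff_ofScalars, mul_comm] using h t
  have h0 := hp.eq_zero
  funext n
  have := congrArg (fun p => FormalMultilinearSeries.coeff p n) h0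
  rw [FormalMultilinearSeries.coeff_ofScalars] at this
  exact this

/-- A power series in `m` real variables converging to `0` everywhere has zero coefficients. -/
theorem eq_zero_of_hasSum_mul_prod_pow_zero {m : ℕ} {c : (Fin m → ℕ) → ℝ}
    (h : ∀ w : Fin m → ℝ, HasSum (fun n => c n * ∏ l, w l ^ n l) 0) : c = 0 := by
  induction m with
  | zero =>
    funext n
    have h1 := (h 0).unique (hasSum_unique _)
    rw [Finset.univ_eq_empty, Finset.prod_empty, mul_one] at h1
    exact (congrArg c (Subsingleton.elim n _)).trans h1.symm
  | succ m ih =>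
    have hprod : ∀ (t : ℝ) (w : Fin m → ℝ), HasSum
        (fun p : ℕ × (Fin m → ℕ) =>
          t ^ p.1 * (c (Fin.cons p.1 p.2) * ∏ l, w l ^ p.2 l)) 0 := by
      intro t w
      refine ((Fin.consEquiv fun _ => ℕ).hasSum_iff.mpr (h (Fin.cons t w))).congr_fun ?_
      intro p
      simp [Fin.consEquiv, Fin.prod_univ_succ]
      ring
    have hfib : ∀ (w : Fin m → ℝ) (a : ℕ),
        Summable fun n => c (Fin.cons a n) * ∏ l, w l ^ n l := by
      intro w a
      simpa using (hprod 1 w).summable.prod_factor a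
    have hzero : ∀ (w : Fin m → ℝ) (a : ℕ),
        HasSum (fun n => c (Fin.cons a n) * ∏ l, w l ^ n l) 0 := by
      intro w a
      have hone : (fun a => ∑' n, c (Fin.cons a n) * ∏ l, w l ^ n l) = 0 := by
        refine eq_zero_of_hasSum_mul_pow_zero fun t => ?_
        simpa [mul_comm] using
          (hprod t w).prod_fiberwise fun a => (hfib w a).hasSum.mul_left (t ^ a)
      simpa [congrFun hone a] using (hfib w a).hasSum
    funext n
    have := congrFun (ih fun w => hzero w (n 0)) (Fin.tail n)
    simpa using this

/-- The product over `k` of the `f k`-labelled factors, an unlabelled `k` contributing `1`,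
regroups according to the fibers of `f`. -/
theorem prod_option_elim_mul {ι κ : Type*} [Fintype ι] [Fintype κ] [DecidableEq ι]
    (w : ι → ℝ) (v : ι → κ → ℝ) (f : κ → Option ι) :
    ∏ k, (f k).elim 1 (fun l => w l * v l k)
      = (∏ l, ∏ k with f k = some l, v l k)
        * ∏ l, w l ^ (Finset.univ.filter fun k => f k = some l).card := by
  have hk : ∀ k, (f k).elim 1 (fun l => w l * v l k)
      = ∏ l, if f k = some l then w l * v l k else 1 := by
    intro k
    cases f k <;> simp
  simp_rw [hk]
  rw [Finset.prod_comm, ← Finset.prod_mul_distrib]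
  refine Finset.prod_congr rfl fun l _ => ?_
  rw [← Finset.prod_filter, Finset.prod_mul_distrib, Finset.prod_const, mul_comm]

/-- Expansion of `∏ k, (1 + ∑ l, w l * v l k)` over partial labellings of the factors. -/
theorem prod_one_add_sum_eq_sum {ι κ : Type*} [Fintype ι] [Fintype κ] [DecidableEq ι]
    [DecidableEq κ] (w : ι → ℝ) (v : ι → κ → ℝ) :
    ∏ k, (1 + ∑ l, w l * v l k)
      = ∑ f : κ → Option ι, (∏ l, ∏ k with f k = some l, v l k)
        * ∏ l, w l ^ (Finset.univ.filter fun k => f k = some l).card := by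
  simp_rw [← prod_option_elim_mul]
  rw [← Fintype.prod_sum fun k (o : Option ι) => o.elim 1 (fun l => w l * v l k)]
  simp [Fintype.sum_option]

/-- The fibers of partial labellings with prescribed sizes are exactly the families of pairwise
disjoint sets with these sizes. -/
theorem bijective_fibers_of_partial_labelling {ι κ : Type*} [Fintype κ] [DecidableEq ι]
    [DecidableEq κ] (n : ι → ℕ) :
    Function.Bijective
      (fun f : {f : κ → Option ι //
          (fun l => (Finset.univ.filter fun k => f k = some l).card) = n} =>
        (⟨fun l => Finset.univ.filter fun k => f.1 k = some l, fun l => congrFun f.2 l, by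
          intro l l' hl
          rw [Finset.disjoint_left]
          intro k hk hk'
          simp only [Finset.mem_filter, Finset.mem_univ, true_and] at hk hk'
          exact hl (Option.some.inj (hk.symm.trans hk'))⟩ :
        {A : ι → Finset κ //
          (∀ l, (A l).card = n l) ∧ ∀ l l', l ≠ l' → Disjoint (A l) (A l')})) := by
  classical
  constructor
  · rintro ⟨f, hf⟩ ⟨g, hg⟩ h
    simp only [Subtype.mk.injEq] at h ⊢
    funext k
    refine Option.ext fun l => ?_
    simpa using congrArg (k ∈ ·) (congrFun h l)
  · rintro ⟨A, hA, hd⟩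
    let f : κ → Option ι := fun k => if h : ∃ l, k ∈ A l then some h.choose else none
    have hf : ∀ k l, f k = some l ↔ k ∈ A l := by
      intro k l
      by_cases h : ∃ l, k ∈ A l
      · simp only [f, h, dif_pos, Option.some.injEq]
        refine ⟨fun e => e ▸ h.choose_spec, fun hl => ?_⟩
        by_contra hne
        exact Finset.disjoint_left.mp (hd _ _ hne) h.choose_spec hl
      · simp only [f, h, dif_neg, not_false_eq_true, reduceCtorEq, false_iff]
        exact fun hl => h ⟨l, hl⟩
    have hfA : (fun l => Finset.univ.filter fun k => f k = some l) = A := by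
      funext l
      ext k
      simp [hf]
    exact ⟨⟨f, funext fun l => (congrArg Finset.card (congrFun hfA l)).trans (hA l)⟩,
      Subtype.ext hfA⟩


/-- If `Z_1,…,Z_N` take values in `{1,…,d}` and `X_i = #{k : Z_k = i}`, then the
multivariate Krawtchouk polynomial `Q_n(X;u)`, defined as the coefficient of
`Π_l w_l^{n_l}` in `Π_j (1 + Σ_l w_l u_j^{(l)})^{x_j}`, admits the symmetrized
representation
`Q_n(X;u) = Σ_{{A_l}} Π_{k∈A_1} u^{(1)}_{Z_k} ⋯ Π_{k∈A_{d-1}} u^{(d-1)}_{Z_k}`,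
the sum being over families of pairwise disjoint subsets `A_1,…,A_{d-1}` of
`{1,…,N}` with `|A_l| = n_l`. -/
theorem multivariate_krawtchouk_symmetrized_representation
    (d N : ℕ) (u : Fin (d - 1) → Fin d → ℝ)
    (Q : (Fin (d - 1) → ℕ) → (Fin d → ℕ) → ℝ)
    (hgen : ∀ (x : Fin d → ℕ) (w : Fin (d - 1) → ℝ),
      HasSum (fun n : Fin (d - 1) → ℕ => Q n x * ∏ l, w l ^ n l)
        (∏ j, (1 + ∑ l, w l * u l j) ^ x j))
    (Z : Fin N → Fin d) (X : Fin d → ℕ)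
    (hX : ∀ i, X i = (Finset.univ.filter (fun k => Z k = i)).card)
    (n : Fin (d - 1) → ℕ) :
    Q n X
      = ∑' A : {A : Fin (d - 1) → Finset (Fin N) //
            (∀ l, (A l).card = n l) ∧
            ∀ l l', l ≠ l' → Disjoint (A l) (A l')},
          ∏ l, ∏ k ∈ A.1 l, u l (Z k) := by
  classical
  let cnt : (Fin N → Option (Fin (d - 1))) → Fin (d - 1) → ℕ :=
    fun f l => (Finset.univ.filter fun k => f k = some l).card
  let a : (Fin N → Option (Fin (d - 1))) → ℝ :=
    fun f => ∏ l, ∏ k with f k = some l, u l (Z k)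
  have hexp : ∀ w : Fin (d - 1) → ℝ,
      ∏ j, (1 + ∑ l, w l * u l j) ^ X j = ∑ f, a f * ∏ l, w l ^ cnt f l := by
    intro w
    rw [← prod_one_add_sum_eq_sum w fun l k => u l (Z k), ← Finset.prod_fiberwise _ Z]
    refine Finset.prod_congr rfl fun j _ => ?_
    rw [hX, ← Finset.prod_const]
    refine Finset.prod_congr rfl fun k hk => ?_
    rw [(Finset.mem_filter.mp hk).2]
  have hsum : ∀ w : Fin (d - 1) → ℝ,
      HasSum (fun n => (∑ f with cnt f = n, a f) * ∏ l, w l ^ n l)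
        (∑ f, a f * ∏ l, w l ^ cnt f l) := by
    intro w
    refine (hasSum_sum fun f _ => hasSum_ite_eq (cnt f) (a f * ∏ l, w l ^ cnt f l)).congr_fun ?_
    intro n
    rw [Finset.sum_mul, Finset.sum_filter]
    refine Finset.sum_congr rfl fun f _ => ?_
    by_cases h : cnt f = n
    · simp [h]
    · simp [h, Ne.symm h]
  have hdiff : (fun n => Q n X - ∑ f with cnt f = n, a f) = 0 := by
    refine eq_zero_of_hasSum_mul_prod_pow_zero fun w => ?_
    simpa [sub_mul, hexp w] using (hgen X w).sub (hsum w)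
  rw [sub_eq_zero.mp (congrFun hdiff n),
    ← (Equiv.ofBijective _ (bijective_fibers_of_partial_labelling n)).tsum_eq, tsum_fintype]
  exact Finset.sum_subtype _ (fun f => by simp [cnt]) a
end

section
/- The multivariate Poisson-Charlier polynomials C_n(X;μ,u), generated as coefficients of w_0^{n_0}⋯w_{d-1}^{n_{d-1}} in e^{w_0} Π_{i=1}^d (1 - w_0/|μ| + |μ|^{-1} Σ_{j=1}^{d-1} u_i^{(j)} w_j)^{X_i}, satisfy E[C_m(X;μ,u) C_n(X;μ,u)] = δ_{mn} |μ|^{-|n|} Π_{j=0}^{d-1} a_j^{n_j}/n_j!, where X = (X_1,…,X_d) are independent Poisson with means μ = (μ_1,…,μ_d). -/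
theorem HasSum.mul_real {α β : Type*} {f : α → ℝ} {g : β → ℝ} {s t : ℝ}
    (hf : HasSum f s) (hg : HasSum g t) : HasSum (fun p : α × β => f p.1 * g p.2) (s * t) :=
  hf.mul hg (summable_mul_of_summable_norm hf.summable.norm hg.summable.norm)

/-- A product of sums of real series is the sum, over tuples of indices, of the products. -/
theorem hasSum_prod_fin {d : ℕ} {f : Fin d → ℕ → ℝ} {s : Fin d → ℝ}
    (h : ∀ i, HasSum (f i) (s i)) :
    HasSum (fun x : Fin d → ℕ => ∏ i, f i (x i)) (∏ i, s i) := by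
  induction d with
  | zero => simp
  | succ d ih =>
    have hmul := (h 0).mul_real (ih fun i => h i.succ)
    rw [Fin.prod_univ_succ, ← (Fin.consEquiv fun _ => ℕ).hasSum_iff]
    refine HasSum.congr_fun hmul fun p => ?_
    simp [Fin.prod_univ_succ, Fin.consEquiv]

/-- The monomial `∏ j, w j ^ n j`. -/
def monom {ι : Type*} [Fintype ι] (w : ι → ℝ) (n : ι → ℕ) : ℝ := ∏ j, w j ^ n j

section monom

variable {ι : Type*} [Fintype ι]

theorem monom_add (w : ι → ℝ) (m n : ι → ℕ) : monom w (m + n) = monom w m * monom w n := by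
  simp [monom, pow_add, Finset.prod_mul_distrib]

@[simp] theorem monom_zero (w : ι → ℝ) : monom w 0 = 1 := by simp [monom]

@[simp] theorem monom_one (n : ι → ℕ) : monom (fun _ => 1) n = 1 := by simp [monom]

@[simp] theorem monom_single [DecidableEq ι] (w : ι → ℝ) (j : ι) (k : ℕ) :
    monom w (Pi.single j k) = w j ^ k := by
  rw [monom, Finset.prod_eq_single j] <;> simp +contextual

theorem abs_monom (w : ι → ℝ) (n : ι → ℕ) : |monom w n| = monom (fun j => |w j|) n := by
  simp [monom, Finset.abs_prod, abs_pow]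

theorem monom_smul (t : ℝ) (w : ι → ℝ) (n : ι → ℕ) :
    monom (fun j => t * w j) n = t ^ (∑ j, n j) * monom w n := by
  simp [monom, mul_pow, Finset.prod_mul_distrib, Finset.prod_pow_eq_pow_sum]

theorem monom_nonneg {w : ι → ℝ} (hw : ∀ j, 0 ≤ w j) (n : ι → ℕ) : 0 ≤ monom w n :=
  Finset.prod_nonneg fun j _ => pow_nonneg (hw j) _

end monom

theorem eq_zero_of_hasSum_pow_zero {b : ℕ → ℝ} (h : ∀ t : ℝ, HasSum (fun k => t ^ k * b k) 0) :
    b = 0 := by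
  have hp : HasFPowerSeriesAt (fun _ : ℝ => (0 : ℝ)) (FormalMultilinearSeries.ofScalars ℝ b) 0 := by
    rw [hasFPowerSeriesAt_iff]
    refine Filter.Eventually.of_forall fun z => ?_
    simpa [FormalMultilinearSeries.coeff_ofScalars] using h z
  exact (FormalMultilinearSeries.ofScalars_series_eq_zero ℝ).mp hp.eq_zero

section unique

variable {ι : Type*} [Fintype ι]

/-- An everywhere convergent power series in several variables that vanishes identically has
vanishing coefficients. -/
theorem eq_zero_of_hasSum_monom_zero {c : (ι → ℕ) → ℝ}
    (h : ∀ w : ι → ℝ, HasSum (fun n => c n * monom w n) 0) : c = 0 := by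
  classical
  have hdeg : ∀ w : ι → ℝ, (fun k => ∑ n ∈ Finset.piAntidiag Finset.univ k, c n * monom w n) = 0 := by
    intro w
    refine eq_zero_of_hasSum_pow_zero fun t => ?_
    have h1 := (h fun j => t * w j).tsum_fiberwise fun n => ∑ j, n j
    refine HasSum.congr_fun h1 fun k => ?_
    have hk (n : (fun n : ι → ℕ => ∑ j, n j) ⁻¹' {k}) :
        c n * monom (fun j => t * w j) n = t ^ k * (c n * monom w n) := by
      rw [monom_smul, show ∑ j, (n : ι → ℕ) j = k from n.2]
      ring
    rw [tsum_congr hk, tsum_mul_left]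
    congr 1
    rw [← Finset.tsum_subtype']
    refine congrArg (fun s : Set (ι → ℕ) => ∑' n : s, c n * monom w n) ?_
    ext n
    simp
  funext n
  let p : MvPolynomial ι ℝ := ∑ m ∈ Finset.piAntidiag Finset.univ (∑ j, n j),
    MvPolynomial.monomial (Finsupp.equivFunOnFinite.symm m) (c m)
  have hp : p = 0 := by
    refine MvPolynomial.funext fun w => ?_
    have := congrFun (hdeg w) (∑ j, n j)
    simpa [p, MvPolynomial.eval_monomial, monom, Finsupp.prod_fintype] using this
  have hc := congrArg (MvPolynomial.coeff (Finsupp.equivFunOnFinite.symm n)) hp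
  simpa [p, MvPolynomial.coeff_sum, MvPolynomial.coeff_monomial] using hc

theorem eq_of_hasSum_monom {c c' : (ι → ℕ) → ℝ} {f : (ι → ℝ) → ℝ}
    (h : ∀ w, HasSum (fun n => c n * monom w n) (f w))
    (h' : ∀ w, HasSum (fun n => c' n * monom w n) (f w)) : c = c' := by
  refine sub_eq_zero.mp (eq_zero_of_hasSum_monom_zero fun w => ?_)
  simpa [sub_mul] using (h w).sub (h' w)

/-- `f` is an everywhere absolutely convergent sum of monomials, and `F` is the sum of
their absolute values on nonnegative arguments. -/
def HasMajorant (f F : (ι → ℝ) → ℝ) : Prop :=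
  ∃ (A : Type) (c : A → ℝ) (e : A → ι → ℕ),
    (∀ w, HasSum (fun α => c α * monom w (e α)) (f w)) ∧
    ∀ w, HasSum (fun α => |c α| * monom w (e α)) (F w)

namespace HasMajorant

variable {f g F G : (ι → ℝ) → ℝ}

theorem one : HasMajorant (fun _ : ι → ℝ => 1) fun _ => 1 :=
  ⟨Unit, fun _ => 1, fun _ => 0, fun w => by simp, fun w => by simp⟩

theorem mul (hf : HasMajorant f F) (hg : HasMajorant g G) :
    HasMajorant (fun w => f w * g w) fun w => F w * G w := by
  obtain ⟨A, c, e, h1, h2⟩ := hf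
  obtain ⟨B, c', e', h1', h2'⟩ := hg
  refine ⟨A × B, fun p => c p.1 * c' p.2, fun p => e p.1 + e' p.2, fun w => ?_, fun w => ?_⟩
  · refine HasSum.congr_fun ((h1 w).mul_real (h1' w)) fun p => ?_
    rw [monom_add]; ring
  · refine HasSum.congr_fun ((h2 w).mul_real (h2' w)) fun p => ?_
    rw [monom_add, abs_mul]; ring

theorem pow (hf : HasMajorant f F) (k : ℕ) :
    HasMajorant (fun w => f w ^ k) fun w => F w ^ k := by
  induction k with
  | zero => simpa using one
  | succ k ih => simpa only [pow_succ] using ih.mul hf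

theorem prod {κ : Type*} (s : Finset κ) {f F : κ → (ι → ℝ) → ℝ}
    (h : ∀ i, HasMajorant (f i) (F i)) :
    HasMajorant (fun w => ∏ i ∈ s, f i w) fun w => ∏ i ∈ s, F i w := by
  classical
  induction s using Finset.induction_on with
  | empty => simpa using one
  | insert i s hi ih => simpa only [Finset.prod_insert hi] using (h i).mul ih

theorem exp (j : ι) :
    HasMajorant (fun w : ι → ℝ => Real.exp (w j)) fun w => Real.exp (w j) := by
  classical
  have key (w : ι → ℝ) : HasSum (fun k : ℕ => ((k.factorial : ℝ)⁻¹) * w j ^ k) (Real.exp (w j)) := by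
    have := NormedSpace.expSeries_div_hasSum_exp (w j)
    rw [← Real.exp_eq_exp_ℝ] at this
    simpa [div_eq_inv_mul] using this
  exact ⟨ℕ, fun k => (k.factorial : ℝ)⁻¹, fun k => Pi.single j k,
    fun w => by simpa using key w, fun w => by simpa using key w⟩

theorem one_add_linear {d : ℕ} (c : Fin d → ℝ) :
    HasMajorant (fun w => 1 + ∑ j, c j * w j) fun w => 1 + ∑ j, |c j| * w j := by
  refine ⟨Option (Fin d), fun o => o.elim 1 c, fun o => o.elim 0 fun j => Pi.single j 1,
    fun w => ?_, fun w => ?_⟩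
  · simpa [Fintype.sum_option] using hasSum_fintype fun o : Option (Fin d) =>
      o.elim 1 c * monom w (o.elim 0 fun j => Pi.single j 1)
  · simpa [Fintype.sum_option] using hasSum_fintype fun o : Option (Fin d) =>
      |o.elim 1 c| * monom w (o.elim 0 fun j => Pi.single j 1)

/-- The coefficients of a power series are bounded by those of a majorant. -/
theorem summable_abs_and_tsum_le (hf : HasMajorant f F) {C : (ι → ℕ) → ℝ}
    (hC : ∀ w, HasSum (fun n => C n * monom w n) (f w)) (w : ι → ℝ) :
    Summable (fun n => |C n * monom w n|) ∧
      ∑' n, |C n * monom w n| ≤ F fun j => |w j| := by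
  refine ⟨(hC w).summable.norm, ?_⟩
  obtain ⟨A, c, e, h1, h2⟩ := hf
  have hc : Summable c := by simpa using (h1 fun _ => 1).summable
  have hCe : C = fun n => ∑' α : e ⁻¹' {n}, c α := by
    refine eq_of_hasSum_monom hC fun w => ?_
    refine HasSum.congr_fun ((h1 w).tsum_fiberwise e) fun n => ?_
    rw [← tsum_mul_right]
    exact tsum_congr fun α => by rw [show e α = n from α.2]
  have h3 := (h2 fun j => |w j|).tsum_fiberwise e
  rw [← h3.tsum_eq]
  refine (hC w).summable.norm.tsum_le_tsum (fun n => ?_) h3.summable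
  have hfib : (∑' α : e ⁻¹' {n}, |c α| * monom (fun j => |w j|) (e α))
      = (∑' α : e ⁻¹' {n}, |c α|) * monom (fun j => |w j|) n := by
    rw [← tsum_mul_right]
    exact tsum_congr fun α => by rw [show e α = n from α.2]
  rw [hfib, hCe, abs_mul, abs_monom]
  refine mul_le_mul_of_nonneg_right ?_ (monom_nonneg (fun _ => abs_nonneg _) _)
  exact norm_tsum_le_tsum_norm (hc.norm.subtype _)

end HasMajorant

end unique

/-- The probability generating function of independent Poisson variables. -/
theorem hasSum_poisson_pgf {d : ℕ} (μ t : Fin d → ℝ) :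
    HasSum (fun x : Fin d → ℕ =>
      (∏ i, Real.exp (-μ i) * μ i ^ x i / (x i).factorial) * ∏ i, t i ^ x i)
      (∏ i, Real.exp (-μ i + μ i * t i)) := by
  have key (i : Fin d) : HasSum
      (fun k : ℕ => Real.exp (-μ i) * ((μ i * t i) ^ k / k.factorial))
      (Real.exp (-μ i + μ i * t i)) := by
    have := NormedSpace.expSeries_div_hasSum_exp (μ i * t i)
    rw [← Real.exp_eq_exp_ℝ] at this
    rw [Real.exp_add]
    exact this.mul_left _
  refine (hasSum_prod_fin key).congr_fun fun x => ?_
  rw [← Finset.prod_mul_distrib]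
  exact Finset.prod_congr rfl fun i _ => by rw [mul_pow]; ring

theorem hasSum_exp_sum_mul {d : ℕ} (b w : Fin d → ℝ) :
    HasSum (fun n : Fin d → ℕ => (∏ j, b j ^ n j / (n j).factorial) * monom w n)
      (Real.exp (∑ j, b j * w j)) := by
  have := hasSum_prod_fin fun j => NormedSpace.expSeries_div_hasSum_exp (b j * w j)
  rw [← Real.exp_eq_exp_ℝ, ← Real.exp_sum] at this
  refine this.congr_fun fun n => ?_
  rw [monom, ← Finset.prod_mul_distrib]
  exact Finset.prod_congr rfl fun j _ => by rw [mul_pow]; ring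

/-- A double power series equal to `∑ n, K n * w ^ n * z ^ n` is diagonal. -/
theorem eq_diagonal_of_hasSum {ι : Type*} [Fintype ι] [DecidableEq (ι → ℕ)]
    {E : (ι → ℕ) → (ι → ℕ) → ℝ} {K : (ι → ℕ) → ℝ} {S : (ι → ℝ) → (ι → ℝ) → ℝ}
    (hE : ∀ w z, HasSum
      (fun p : (ι → ℕ) × (ι → ℕ) => E p.1 p.2 * (monom w p.1 * monom z p.2)) (S w z))
    (hK : ∀ w z, HasSum (fun n => K n * monom w n * monom z n) (S w z)) (m n : ι → ℕ) :
    E m n = if m = n then K n else 0 := by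
  have hsum (w : ι → ℝ) (n : ι → ℕ) : Summable fun m => E m n * monom w m := by
    have := (hE w fun _ => 1).summable.prod_symm.prod_factor n
    simpa using this
  have hcol (w : ι → ℝ) : (fun n => ∑' m, E m n * monom w m) = fun n => K n * monom w n := by
    refine eq_of_hasSum_monom (fun z => ?_) (hK w)
    refine HasSum.prod_fiberwise ((Equiv.prodComm _ _).hasSum_iff.mpr (hE w z)) fun n => ?_
    refine ((hsum w n).hasSum.mul_right (monom z n)).congr_fun fun m => ?_
    simp [mul_assoc]
  have huniq : (fun m => E m n) = fun m => if m = n then K n else 0 := by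
    refine eq_of_hasSum_monom (f := fun w => K n * monom w n) (fun w => ?_) fun w => ?_
    · rw [← congrFun (hcol w) n]
      exact (hsum w n).hasSum
    · convert hasSum_ite_eq n (K n * monom w n) using 2 with m
      split_ifs with h <;> simp [h]
  exact congrFun huniq m

/-- Coefficients of generating functions may be multiplied and summed against weights termwise,
when the majorants are summable. -/
theorem hasSum_sum_coeff_mul_coeff {ι X : Type*} [Fintype ι] {P : X → ℝ} (hP : ∀ x, 0 ≤ P x)
    {C : (ι → ℕ) → X → ℝ} {G F : X → (ι → ℝ) → ℝ} (hG : ∀ x, HasMajorant (G x) (F x))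
    (hC : ∀ x w, HasSum (fun n => C n x * monom w n) (G x w))
    (hF : ∀ w z, Summable fun x => P x * (F x w * F x z)) {w z : ι → ℝ} {s : ℝ}
    (hs : HasSum (fun x => P x * (G x w * G x z)) s) :
    HasSum (fun p : (ι → ℕ) × (ι → ℕ) =>
      (∑' x, P x * (C p.1 x * C p.2 x)) * (monom w p.1 * monom z p.2)) s := by
  set T : X × ((ι → ℕ) × (ι → ℕ)) → ℝ := fun q =>
    P q.1 * ((C q.2.1 q.1 * monom w q.2.1) * (C q.2.2 q.1 * monom z q.2.2)) with hT
  have hfib (x : X) : HasSum (fun p => T (x, p)) (P x * (G x w * G x z)) :=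
    ((hC x w).mul_real (hC x z)).mul_left (P x)
  have habs (x : X) : HasSum (fun p => |T (x, p)|)
      (P x * ((∑' n, |C n x * monom w n|) * ∑' n, |C n x * monom z n|)) := by
    have := (((hC x w).summable.norm.hasSum).mul_real
      (hC x z).summable.norm.hasSum).mul_left (P x)
    refine this.congr_fun fun p => ?_
    simp only [hT, abs_mul, abs_of_nonneg (hP x), Real.norm_eq_abs]
  have hsummable : Summable T := by
    refine Summable.of_norm ((summable_prod_of_nonneg fun _ => norm_nonneg _).mpr
      ⟨fun x => (habs x).summable, ?_⟩)
    refine Summable.of_nonneg_of_le (fun x => tsum_nonneg fun _ => norm_nonneg _) (fun x => ?_)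
      (hF (fun j => |w j|) fun j => |z j|)
    have hw := ((hG x).summable_abs_and_tsum_le (hC x) w).2
    have hz := ((hG x).summable_abs_and_tsum_le (hC x) z).2
    have h0 (v : ι → ℝ) : 0 ≤ ∑' n, |C n x * monom v n| := tsum_nonneg fun _ => abs_nonneg _
    refine (habs x).tsum_eq.le.trans ?_
    exact mul_le_mul_of_nonneg_left (mul_le_mul hw hz (h0 z) ((h0 w).trans hw)) (hP x)
  have hTs : HasSum T s := by
    rw [hs.unique (hsummable.hasSum.prod_fiberwise hfib)]
    exact hsummable.hasSum
  have hswap := (Equiv.prodComm _ _).hasSum_iff.mpr hTs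
  refine hswap.prod_fiberwise fun p => ?_
  refine (Summable.hasSum_iff (hswap.summable.prod_factor p)).mpr ?_
  rw [← tsum_mul_right]
  refine tsum_congr fun x => ?_
  simp only [hT, Function.comp_apply, Equiv.prodComm_apply, Prod.swap_prod_mk]
  ring

section generatingFunction

variable {d : ℕ} [NeZero d] (μ : Fin d → ℝ)

/-- The generating function `e^{w_0} ∏ i, (1 + ∑ j, c i j * w j) ^ x i`. -/
noncomputable def charlierGen (c : Fin d → Fin d → ℝ) (x : Fin d → ℕ) (w : Fin d → ℝ) : ℝ :=
  Real.exp (w 0) * ∏ i, (1 + ∑ j, c i j * w j) ^ x i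

theorem hasMajorant_charlierGen (c : Fin d → Fin d → ℝ) (x : Fin d → ℕ) :
    HasMajorant (charlierGen c x) (charlierGen (fun i j => |c i j|) x) :=
  (HasMajorant.exp 0).mul (HasMajorant.prod _ fun _ => (HasMajorant.one_add_linear _).pow _)

theorem hasSum_poisson_charlierGen_mul (c : Fin d → Fin d → ℝ) (w z : Fin d → ℝ) :
    HasSum (fun x : Fin d → ℕ => (∏ i, Real.exp (-μ i) * μ i ^ x i / (x i).factorial) *
      (charlierGen c x w * charlierGen c x z))
      (Real.exp (w 0) * Real.exp (z 0) * ∏ i, Real.exp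
        (-μ i + μ i * ((1 + ∑ j, c i j * w j) * (1 + ∑ j, c i j * z j)))) := by
  refine ((hasSum_poisson_pgf μ fun i =>
    (1 + ∑ j, c i j * w j) * (1 + ∑ j, c i j * z j)).mul_left _).congr_fun fun x => ?_
  simp only [charlierGen, mul_pow, Finset.prod_mul_distrib]
  ring

theorem hasSum_poisson_charlierGen_mul_of_orthogonal {c : Fin d → Fin d → ℝ} {q : Fin d → ℝ}
    (hlin : ∀ j, ∑ i, μ i * c i j = if j = 0 then -1 else 0)
    (hquad : ∀ j k, ∑ i, μ i * c i j * c i k = if j = k then q j else 0) (w z : Fin d → ℝ) :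
    HasSum (fun x : Fin d → ℕ => (∏ i, Real.exp (-μ i) * μ i ^ x i / (x i).factorial) *
      (charlierGen c x w * charlierGen c x z)) (Real.exp (∑ j, q j * w j * z j)) := by
  have hl (w : Fin d → ℝ) : ∑ i, μ i * ∑ j, c i j * w j = -w 0 := by
    simp only [Finset.mul_sum]
    rw [Finset.sum_comm]
    simp only [← mul_assoc, ← Finset.sum_mul, hlin]
    simp
  have hq : ∑ i, μ i * ((∑ j, c i j * w j) * ∑ k, c i k * z k) = ∑ j, q j * w j * z j := by
    have hexp (i : Fin d) : μ i * ((∑ j, c i j * w j) * ∑ k, c i k * z k)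
        = ∑ j, ∑ k, μ i * c i j * c i k * (w j * z k) := by
      rw [Finset.sum_mul_sum, Finset.mul_sum]
      refine Finset.sum_congr rfl fun j _ => ?_
      rw [Finset.mul_sum]
      exact Finset.sum_congr rfl fun k _ => by ring
    simp only [hexp]
    rw [Finset.sum_comm]
    refine Finset.sum_congr rfl fun j _ => ?_
    rw [Finset.sum_comm]
    simp only [← Finset.sum_mul, hquad]
    simp [mul_assoc]
  have hval : Real.exp (∑ j, q j * w j * z j) = Real.exp (w 0) * Real.exp (z 0) *
      ∏ i, Real.exp (-μ i + μ i * ((1 + ∑ j, c i j * w j) * (1 + ∑ j, c i j * z j))) := by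
    rw [← Real.exp_sum, ← Real.exp_add, ← Real.exp_add, ← hq]
    have hexp (i : Fin d) :
        -μ i + μ i * ((1 + ∑ j, c i j * w j) * (1 + ∑ j, c i j * z j))
          = μ i * (∑ j, c i j * w j) + μ i * (∑ j, c i j * z j)
            + μ i * ((∑ j, c i j * w j) * ∑ j, c i j * z j) := by ring
    simp only [hexp, Finset.sum_add_distrib, hl]
    congr 1
    ring
  rw [hval]
  exact hasSum_poisson_charlierGen_mul μ c w z

end generatingFunction

/-- Orthogonality of the multivariate Poisson-Charlier polynomials `C_n(X;μ,u)`,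
generated as coefficients of `w_0^{n_0}⋯w_{d-1}^{n_{d-1}}` in
`e^{w_0} Π_i (1 - w_0/|μ| + |μ|⁻¹ Σ_{j≥1} u_i^{(j)} w_j)^{X_i}`, with respect to a
product of Poisson distributions with means `μ`:
`E[C_m C_n] = δ_{mn} |μ|^{-|n|} Π_j a_j^{n_j}/n_j!`. -/
theorem multivariate_poisson_charlier_orthogonality
    (d : ℕ) [NeZero d] (μ : Fin d → ℝ) (hμ : ∀ i, 0 < μ i)
    (a : Fin d → ℝ) (u : Fin d → Fin d → ℝ)
    (hu0 : ∀ i, u 0 i = 1) (ha0 : a 0 = 1)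
    (horth : ∀ k l, ∑ i, u k i * u l i * (μ i / ∑ i', μ i') = if k = l then a k else 0)
    (C : (Fin d → ℕ) → (Fin d → ℕ) → ℝ)
    (hgen : ∀ (x : Fin d → ℕ) (w : Fin d → ℝ),
      HasSum (fun n : Fin d → ℕ => C n x * ∏ j, w j ^ n j)
        (Real.exp (w 0) * ∏ i,
          (1 - w 0 / (∑ i', μ i')
            + (∑ i', μ i')⁻¹ * ∑ j ∈ Finset.univ.erase 0, u j i * w j) ^ x i)) :
    ∀ m n : Fin d → ℕ,
      (∑' x : Fin d → ℕ,
          (∏ i, Real.exp (-μ i) * μ i ^ x i / (x i).factorial) * (C m x * C n x))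
        = if m = n then
            (∑ i', μ i') ^ (-(∑ j, n j : ℝ)) * ∏ j, a j ^ n j / (n j).factorial
          else 0 := by
  set M : ℝ := ∑ i', μ i'
  have hMpos : 0 < M := Finset.sum_pos (fun i _ => hμ i) Finset.univ_nonempty
  let s : Fin d → ℝ := fun j => if j = 0 then -1 else 1
  let c : Fin d → Fin d → ℝ := fun i j => s j * u j i / M
  have hC (x w) : HasSum (fun n => C n x * monom w n) (charlierGen c x w) := by
    have hfactor (i : Fin d) :
        1 - w 0 / M + M⁻¹ * ∑ j ∈ Finset.univ.erase 0, u j i * w j = 1 + ∑ j, c i j * w j := by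
      have hr : ∑ j ∈ Finset.univ.erase 0, c i j * w j
          = M⁻¹ * ∑ j ∈ Finset.univ.erase 0, u j i * w j := by
        rw [Finset.mul_sum]
        refine Finset.sum_congr rfl fun j hj => ?_
        simp only [c, s, if_neg (Finset.ne_of_mem_erase hj)]
        ring
      rw [← Finset.add_sum_erase Finset.univ (fun j => c i j * w j) (Finset.mem_univ 0), hr]
      simp only [c, s, if_true, hu0]
      ring
    have := hgen x w
    simp only [hfactor] at this
    exact this
  have hlin (j : Fin d) : ∑ i, μ i * c i j = if j = 0 then -1 else 0 := by
    have h : ∑ i, μ i * c i j = s j * ∑ i, u j i * u 0 i * (μ i / M) := by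
      rw [Finset.mul_sum]
      exact Finset.sum_congr rfl fun i _ => by simp only [c, hu0]; ring
    rw [h, horth]
    split_ifs with h0 <;> simp [s, h0, ha0]
  have hquad (j k : Fin d) : ∑ i, μ i * c i j * c i k = if j = k then a j / M else 0 := by
    have h : ∑ i, μ i * c i j * c i k = s j * s k / M * ∑ i, u j i * u k i * (μ i / M) := by
      rw [Finset.mul_sum]
      exact Finset.sum_congr rfl fun i _ => by simp only [c]; ring
    rw [h, horth]
    split_ifs with hjk
    · subst hjk
      by_cases h0 : j = 0 <;> simp [s, h0, div_eq_inv_mul]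
    · simp
  intro m n
  have hE (w z : Fin d → ℝ) := hasSum_sum_coeff_mul_coeff
    (P := fun x : Fin d → ℕ => ∏ i, Real.exp (-μ i) * μ i ^ x i / (x i).factorial)
    (fun x => Finset.prod_nonneg fun i _ => by have := hμ i; positivity)
    (hasMajorant_charlierGen c) hC
    (fun w z => (hasSum_poisson_charlierGen_mul μ _ w z).summable)
    (hasSum_poisson_charlierGen_mul_of_orthogonal μ hlin hquad w z)
  have hK (w z : Fin d → ℝ) : HasSum
      (fun n : Fin d → ℕ => (∏ j, (a j / M) ^ n j / (n j).factorial) * monom w n * monom z n)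
      (Real.exp (∑ j, a j / M * w j * z j)) := by
    refine (hasSum_exp_sum_mul (fun j => a j / M * w j) z).congr_fun fun n => ?_
    congr 1
    rw [monom, ← Finset.prod_mul_distrib]
    exact Finset.prod_congr rfl fun j _ => by rw [mul_pow]; ring
  have hdiag := eq_diagonal_of_hasSum
    (E := fun m n => ∑' x : Fin d → ℕ,
      (∏ i, Real.exp (-μ i) * μ i ^ x i / (x i).factorial) * (C m x * C n x))
    (K := fun n => ∏ j, (a j / M) ^ n j / (n j).factorial)
    (S := fun w z => Real.exp (∑ j, a j / M * w j * z j)) hE hK m n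
  refine hdiag.trans (if_congr Iff.rfl ?_ rfl)
  rw [Real.rpow_neg hMpos.le, ← Nat.cast_sum, Real.rpow_natCast, ← Finset.prod_pow_eq_pow_sum,
    ← Finset.prod_inv_distrib, ← Finset.prod_mul_distrib]
  exact Finset.prod_congr rfl fun j _ => by rw [div_pow]; ring
end

section
/- The transform of the multivariate Poisson-Charlier polynomials is E[Π_{j=1}^d s_j^{X_j} C_n(X;μ,u)] = (Π_{j=0}^{d-1} n_j!)^{-1} exp(Σ_{i=1}^d μ_i(s_i - 1)) (1 - S_0)^{n_0} Π_{j=1}^{d-1} S_j^{n_j}, where S_j = Σ_{i=1}^d p_i s_i u_i^{(j)}. -/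
theorem HasSum.mul_real_s9 {ι κ : Type*} {f : ι → ℝ} {g : κ → ℝ} {a b : ℝ}
    (hf : HasSum f a) (hg : HasSum g b) :
    HasSum (fun q : ι × κ => f q.1 * g q.2) (a * b) :=
  hf.mul hg (summable_mul_of_summable_norm hf.summable.norm hg.summable.norm)

theorem hasSum_prod_apply {d : ℕ} {f : Fin d → ℕ → ℝ} {a : Fin d → ℝ}
    (hf : ∀ i, HasSum (f i) (a i)) :
    HasSum (fun n : Fin d → ℕ => ∏ i, f i (n i)) (∏ i, a i) := by
  induction d with
  | zero => simp [hasSum_unique]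
  | succ d ih =>
    have hs := ih (f := fun i => f i.succ) (a := fun i => a i.succ) fun i => hf i.succ
    have h := (hf 0).mul_real_s9 hs
    rw [← (Fin.consEquiv fun _ : Fin (d + 1) => ℕ).hasSum_iff]
    simpa [Function.comp_def, Fin.prod_univ_succ, Fin.consEquiv] using h

theorem Real.hasSum_pow_div_factorial (t : ℝ) :
    HasSum (fun k : ℕ => t ^ k / (k.factorial : ℝ)) (Real.exp t) := by
  rw [Real.exp_eq_exp_ℝ]
  exact NormedSpace.expSeries_div_hasSum_exp t

theorem hasSum_prod_pow_div_factorial {d : ℕ} (t : Fin d → ℝ) :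
    HasSum (fun n : Fin d → ℕ => ∏ i, t i ^ n i / ((n i).factorial : ℝ))
      (Real.exp (∑ i, t i)) := by
  rw [Real.exp_sum]
  exact hasSum_prod_apply (f := fun i k => t i ^ k / (k.factorial : ℝ)) fun i =>
    Real.hasSum_pow_div_factorial (t i)

theorem eq_zero_of_hasSum_pow {c : ℕ → ℝ} (hc : ∀ t : ℝ, HasSum (fun k => c k * t ^ k) 0) :
    c = 0 := by
  have h : HasFPowerSeriesAt (0 : ℝ → ℝ) (FormalMultilinearSeries.ofScalars ℝ c) 0 := by
    rw [hasFPowerSeriesAt_iff]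
    refine Filter.Eventually.of_forall fun t => ?_
    simpa [FormalMultilinearSeries.coeff_ofScalars, mul_comm] using hc t
  funext k
  have h0 : (0 : FormalMultilinearSeries ℝ ℝ ℝ).coeff k = 0 := rfl
  simpa [h0] using congrArg (fun p => p.coeff k) h.eq_zero

/-- A multivariate power series that sums to zero everywhere has zero coefficients. -/
theorem eq_zero_of_hasSum_prod_pow {d : ℕ} {c : (Fin d → ℕ) → ℝ}
    (hc : ∀ w : Fin d → ℝ, HasSum (fun n => c n * ∏ j, w j ^ n j) 0) : c = 0 := by
  induction d with
  | zero =>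
    funext n
    have h := (hc 0).unique (hasSum_single n fun m hm => (hm (Subsingleton.elim m n)).elim)
    simpa using h.symm
  | succ d ih =>
    have key (w : Fin (d + 1) → ℝ) : HasSum (fun q : ℕ × (Fin d → ℕ) =>
        w 0 ^ q.1 * (c (Fin.cons q.1 q.2) * ∏ j : Fin d, w j.succ ^ q.2 j)) 0 := by
      have h := hc w
      rw [← (Fin.consEquiv fun _ : Fin (d + 1) => ℕ).hasSum_iff] at h
      convert h using 2 with q
      simp [Fin.prod_univ_succ, Fin.consEquiv]
      ring
    have hslice (k : ℕ) : (fun n => c (Fin.cons k n)) = 0 := by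
      refine ih fun w => ?_
      have hsum (l : ℕ) : Summable fun n => c (Fin.cons l n) * ∏ j, w j ^ n j := by
        simpa using (key (Fin.cons 1 w)).summable.prod_factor l
      have hz : (fun l => ∑' n, c (Fin.cons l n) * ∏ j, w j ^ n j) = 0 := by
        refine eq_zero_of_hasSum_pow fun t => ?_
        have h := (key (Fin.cons t w)).prod_fiberwise fun l => by
          simpa using (hsum l).hasSum.mul_left (t ^ l)
        simpa [mul_comm] using h
      have := (hsum k).hasSum
      rwa [show (∑' n, c (Fin.cons k n) * ∏ j, w j ^ n j) = 0 from congrFun hz k] at this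
    funext n
    simpa using congrFun (hslice (n 0)) (Fin.tail n)

theorem eq_of_hasSum_prod_pow {d : ℕ} {c c' : (Fin d → ℕ) → ℝ} {f : (Fin d → ℝ) → ℝ}
    (hc : ∀ w, HasSum (fun n => c n * ∏ j, w j ^ n j) (f w))
    (hc' : ∀ w, HasSum (fun n => c' n * ∏ j, w j ^ n j) (f w)) : c = c' := by
  refine sub_eq_zero.mp (eq_zero_of_hasSum_prod_pow fun w => ?_)
  simpa [sub_mul] using (hc w).sub (hc' w)

/-- `f` is the sum of an everywhere convergent power series whose series of absolute values
is bounded by `B`. -/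
def HasMajorizedExpansion {d : ℕ} (f B : (Fin d → ℝ) → ℝ) : Prop :=
  ∃ c : (Fin d → ℕ) → ℝ, ∀ w, HasSum (fun n => c n * ∏ j, w j ^ n j) (f w) ∧
    ∑' n, |c n * ∏ j, w j ^ n j| ≤ B w

namespace HasMajorizedExpansion

variable {d : ℕ} {f g B D : (Fin d → ℝ) → ℝ}

theorem add (hf : HasMajorizedExpansion f B) (hg : HasMajorizedExpansion g D) :
    HasMajorizedExpansion (fun w => f w + g w) (fun w => B w + D w) := by
  obtain ⟨b, hb⟩ := hf
  obtain ⟨c, hc⟩ := hg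
  refine ⟨fun n => b n + c n, fun w => ⟨?_, ?_⟩⟩
  · simpa [add_mul] using (hb w).1.add (hc w).1
  · have sb := (hb w).1.summable.abs
    have sc := (hc w).1.summable.abs
    simp only [add_mul]
    calc _ ≤ _ := ((hb w).1.add (hc w).1).summable.abs.tsum_le_tsum
            (fun n => abs_add_le _ _) (sb.add sc)
      _ = _ := sb.tsum_add sc
      _ ≤ _ := add_le_add (hb w).2 (hc w).2

theorem const_mul_coord (hf : HasMajorizedExpansion f B) (v : ℝ) (j : Fin d) :
    HasMajorizedExpansion (fun w => v * w j * f w) (fun w => |v| * |w j| * B w) := by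
  obtain ⟨c, hc⟩ := hf
  let e : (Fin d → ℕ) → (Fin d → ℕ) := fun n => n + Pi.single j 1
  have he : Function.Injective e := add_left_injective _
  have hmono (w : Fin d → ℝ) (n : Fin d → ℕ) :
      ∏ k, w k ^ e n k = w j * ∏ k, w k ^ n k := by
    have hj : ∏ k, w k ^ (Pi.single j 1 : Fin d → ℕ) k = w j := by
      rw [Finset.prod_eq_single j] <;> simp +contextual
    simp [e, pow_add, Finset.prod_mul_distrib, hj, mul_comm]
  let b := Function.extend e (fun n => v * c n) 0
  have hbe (n) : b (e n) = v * c n := he.extend_apply _ _ n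
  have hb0 (n) (hn : n ∉ Set.range e) : b n = 0 := Function.extend_apply' _ _ n hn
  have hterm (w : Fin d → ℝ) (n) :
      b (e n) * ∏ k, w k ^ e n k = v * w j * (c n * ∏ k, w k ^ n k) := by
    rw [hbe, hmono]
    ring
  refine ⟨b, fun w => ⟨?_, ?_⟩⟩
  · rw [← he.hasSum_iff fun n hn => by simp [hb0 n hn]]
    simpa only [Function.comp_def, hterm] using (hc w).1.mul_left (v * w j)
  · rw [← he.tsum_eq fun n hn => by
      by_contra h
      exact hn (by simp [hb0 n h])]
    simp only [hterm, abs_mul _ (c _ * _), tsum_mul_left]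
    rw [abs_mul v]
    exact mul_le_mul_of_nonneg_left (hc w).2 (by positivity)

theorem affine_mul (hf : HasMajorizedExpansion f B) (v : Fin d → ℝ) :
    HasMajorizedExpansion (fun w => (1 + ∑ j, v j * w j) * f w)
      (fun w => (1 + ∑ j, |v j| * |w j|) * B w) := by
  suffices h : ∀ t : Finset (Fin d), HasMajorizedExpansion
      (fun w => (1 + ∑ j ∈ t, v j * w j) * f w)
      (fun w => (1 + ∑ j ∈ t, |v j| * |w j|) * B w) from h _
  intro t
  induction t using Finset.induction_on with
  | empty => simpa using hf
  | insert j t hj ih =>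
    convert ih.add (hf.const_mul_coord (v j) j) using 2 with w w <;>
    · rw [Finset.sum_insert hj]
      ring

theorem affine_pow_mul (hf : HasMajorizedExpansion f B) (v : Fin d → ℝ) (k : ℕ) :
    HasMajorizedExpansion (fun w => (1 + ∑ j, v j * w j) ^ k * f w)
      (fun w => (1 + ∑ j, |v j| * |w j|) ^ k * B w) := by
  induction k with
  | zero => simpa using hf
  | succ k ih =>
    convert ih.affine_mul v using 2 <;> ring

theorem prod_affine_pow_mul {ι : Type*} (t : Finset ι) (hf : HasMajorizedExpansion f B)
    (v : ι → Fin d → ℝ) (x : ι → ℕ) :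
    HasMajorizedExpansion (fun w => (∏ i ∈ t, (1 + ∑ j, v i j * w j) ^ x i) * f w)
      (fun w => (∏ i ∈ t, (1 + ∑ j, |v i j| * |w j|) ^ x i) * B w) := by
  classical
  induction t using Finset.induction_on with
  | empty => simpa using hf
  | insert i t hi ih =>
    simpa only [Finset.prod_insert hi, mul_assoc] using ih.affine_pow_mul (v i) (x i)

theorem exp_linear (v : Fin d → ℝ) :
    HasMajorizedExpansion (fun w => Real.exp (∑ j, v j * w j))
      (fun w => Real.exp (∑ j, |v j| * |w j|)) := by
  refine ⟨fun n => ∏ j, v j ^ n j / ((n j).factorial : ℝ), fun w => ⟨?_, ?_⟩⟩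
  · convert hasSum_prod_pow_div_factorial (fun j => v j * w j) using 2 with n
    rw [← Finset.prod_mul_distrib]
    exact Finset.prod_congr rfl fun j _ => by rw [mul_pow]; ring
  · refine (HasSum.tsum_eq ?_).le
    convert hasSum_prod_pow_div_factorial (fun j => |v j| * |w j|) using 2 with n
    rw [← Finset.prod_mul_distrib, Finset.abs_prod]
    refine Finset.prod_congr rfl fun j _ => ?_
    rw [abs_mul, abs_div, abs_pow, abs_pow, Nat.abs_cast, mul_pow]
    ring

theorem tsum_abs_le (hf : HasMajorizedExpansion f B) {c : (Fin d → ℕ) → ℝ}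
    (hc : ∀ w, HasSum (fun n => c n * ∏ j, w j ^ n j) (f w)) (w : Fin d → ℝ) :
    ∑' n, |c n * ∏ j, w j ^ n j| ≤ B w := by
  obtain ⟨b, hb⟩ := hf
  rw [eq_of_hasSum_prod_pow hc fun w => (hb w).1]
  exact (hb w).2

end HasMajorizedExpansion

/-- Coefficientwise summation of a family of generating functions against weights. -/
theorem hasSum_tsum_coeff {d : ℕ} {ι : Type*} {f B : ι → (Fin d → ℝ) → ℝ}
    {c : ι → (Fin d → ℕ) → ℝ} (hf : ∀ x, HasMajorizedExpansion (f x) (B x))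
    (hc : ∀ x w, HasSum (fun n => c x n * ∏ j, w j ^ n j) (f x w))
    (r : ι → ℝ) (hB : ∀ w, Summable fun x => |r x| * B x w) {F : (Fin d → ℝ) → ℝ}
    (hF : ∀ w, HasSum (fun x => r x * f x w) (F w)) (w : Fin d → ℝ) :
    HasSum (fun n => (∑' x, r x * c x n) * ∏ j, w j ^ n j) (F w) := by
  have hrow (x : ι) := (hc x w).mul_left (r x)
  have hs : Summable fun q : ι × (Fin d → ℕ) => r q.1 * (c q.1 q.2 * ∏ j, w j ^ q.2 j) := by
    refine Summable.of_abs ((summable_prod_of_nonneg fun _ => abs_nonneg _).2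
      ⟨fun x => (hrow x).summable.abs, ?_⟩)
    refine (hB w).of_nonneg_of_le (fun x => tsum_nonneg fun _ => abs_nonneg _) fun x => ?_
    simp only [abs_mul (r x), tsum_mul_left]
    exact mul_le_mul_of_nonneg_left ((hf x).tsum_abs_le (hc x) w) (abs_nonneg _)
  have htot := hs.hasSum
  rw [(htot.prod_fiberwise hrow).unique (hF w)] at htot
  have hswap := (Equiv.prodComm (Fin d → ℕ) ι).hasSum_iff.mpr htot
  refine hswap.prod_fiberwise fun n => ?_
  have hn : Summable fun x => r x * (c x n * ∏ j, w j ^ n j) :=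
    hswap.summable.prod_factor n
  rw [← tsum_mul_right]
  simp only [mul_assoc]
  exact hn.hasSum


/-- Transform of the multivariate Poisson-Charlier polynomials:
`E[Π_j s_j^{X_j} C_n(X;μ,u)]
  = (Π_j n_j!)⁻¹ exp(Σ_i μ_i(s_i-1)) (1-S_0)^{n_0} Π_{j≥1} S_j^{n_j}`,
where `S_j = Σ_i p_i s_i u_i^{(j)}` and `X` has independent Poisson(μ_i)
components. -/
theorem multivariate_poisson_charlier_transform
    (d : ℕ) [NeZero d] (μ : Fin d → ℝ) (hμ : ∀ i, 0 < μ i)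
    (a : Fin d → ℝ) (u : Fin d → Fin d → ℝ)
    (hu0 : ∀ i, u 0 i = 1) (ha0 : a 0 = 1)
    (horth : ∀ k l, ∑ i, u k i * u l i * (μ i / ∑ i', μ i') = if k = l then a k else 0)
    (C : (Fin d → ℕ) → (Fin d → ℕ) → ℝ)
    (hgen : ∀ (x : Fin d → ℕ) (w : Fin d → ℝ),
      HasSum (fun n : Fin d → ℕ => C n x * ∏ j, w j ^ n j)
        (Real.exp (w 0) * ∏ i,
          (1 - w 0 / (∑ i', μ i')
            + (∑ i', μ i')⁻¹ * ∑ j ∈ Finset.univ.erase 0, u j i * w j) ^ x i)) :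
    ∀ (n : Fin d → ℕ) (s : Fin d → ℝ),
      (∑' x : Fin d → ℕ,
          (∏ i, Real.exp (-μ i) * μ i ^ x i / (x i).factorial)
            * (∏ j, s j ^ x j) * C n x)
        = (∏ j, ((n j).factorial : ℝ))⁻¹
            * Real.exp (∑ i, μ i * (s i - 1))
            * (1 - ∑ i, (μ i / ∑ i', μ i') * s i * u 0 i) ^ n 0
            * ∏ j ∈ Finset.univ.erase 0,
                (∑ i, (μ i / ∑ i', μ i') * s i * u j i) ^ n j := by
  intro n s
  set M := ∑ i', μ i' with hM
  let v : Fin d → Fin d → ℝ := fun i j => if j = 0 then -M⁻¹ else M⁻¹ * u j i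
  have hv (i : Fin d) (w : Fin d → ℝ) :
      1 + ∑ j, v i j * w j
        = 1 - w 0 / M + M⁻¹ * ∑ j ∈ Finset.univ.erase 0, u j i * w j := by
    rw [← Finset.add_sum_erase _ _ (Finset.mem_univ (0 : Fin d)), Finset.mul_sum,
      Finset.sum_congr rfl fun j hj => show v i j * w j = M⁻¹ * (u j i * w j) by
        simp [v, Finset.ne_of_mem_erase hj, mul_assoc]]
    simp only [v, if_true]
    ring
  let δ : Fin d → ℝ := Pi.single 0 1
  have hδ (w : Fin d → ℝ) : ∑ j, δ j * w j = w 0 := by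
    simp [δ, Pi.single_apply]
  let G : (Fin d → ℕ) → (Fin d → ℝ) → ℝ := fun x w =>
    (∏ i, (1 + ∑ j, v i j * w j) ^ x i) * Real.exp (∑ j, δ j * w j)
  have hC (x : Fin d → ℕ) (w : Fin d → ℝ) :
      HasSum (fun n => C n x * ∏ j, w j ^ n j) (G x w) := by
    simpa only [G, hv, hδ, mul_comm (Real.exp _)] using hgen x w
  let r : (Fin d → ℕ) → ℝ := fun x =>
    (∏ i, Real.exp (-μ i) * μ i ^ x i / (x i).factorial) * ∏ j, s j ^ x j
  have hr (x : Fin d → ℕ) :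
      r x = Real.exp (-M) * ∏ i, (μ i * s i) ^ x i / ((x i).factorial : ℝ) := by
    simp only [r]
    rw [hM, ← Finset.sum_neg_distrib, Real.exp_sum, ← Finset.prod_mul_distrib,
      ← Finset.prod_mul_distrib]
    exact Finset.prod_congr rfl fun i _ => by rw [mul_pow]; ring
  let A : Fin d → ℝ := fun j =>
    if j = 0 then 1 - ∑ i, (μ i / M) * s i * u 0 i else ∑ i, (μ i / M) * s i * u j i
  have hF (w : Fin d → ℝ) : HasSum (fun x => r x * G x w)
      (Real.exp (∑ i, μ i * (s i - 1)) * Real.exp (∑ j, A j * w j)) := by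
    have hexp : -M + ∑ i, μ i * s i * (1 + ∑ j, v i j * w j) + ∑ j, δ j * w j
        = ∑ i, μ i * (s i - 1) + ∑ j, A j * w j := by
      have hA (j : Fin d) : A j = δ j + ∑ i, μ i * s i * v i j := by
        by_cases hj : j = 0
        · subst hj
          simp only [A, δ, v, if_true, Pi.single_eq_same, hu0, sub_eq_add_neg,
            ← Finset.sum_neg_distrib]
          exact congrArg _ (Finset.sum_congr rfl fun i _ => by ring)
        · simp only [A, δ, v, if_neg hj, Pi.single_eq_of_ne hj, zero_add]
          exact Finset.sum_congr rfl fun i _ => by ring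
      simp only [hA, add_mul, Finset.sum_mul, mul_add, mul_one, mul_sub, Finset.mul_sum,
        Finset.sum_add_distrib, Finset.sum_sub_distrib]
      rw [Finset.sum_comm]
      simp only [mul_assoc]
      ring
    have h := ((hasSum_prod_pow_div_factorial
      fun i => μ i * s i * (1 + ∑ j, v i j * w j)).mul_left (Real.exp (-M))).mul_right
        (Real.exp (∑ j, δ j * w j))
    rw [← Real.exp_add, ← Real.exp_add, hexp, Real.exp_add] at h
    refine h.congr_fun fun x => ?_
    simp only [G, hr, ← mul_assoc]
    rw [mul_assoc (Real.exp (-M)), ← Finset.prod_mul_distrib]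
    congr 2
    exact Finset.prod_congr rfl fun i _ => by rw [mul_pow _ (1 + _)]; ring
  have hB (w : Fin d → ℝ) : Summable fun x : Fin d → ℕ =>
      |r x| * ((∏ i, (1 + ∑ j, |v i j| * |w j|) ^ x i)
        * Real.exp (∑ j, |δ j| * |w j|)) := by
    have h := ((hasSum_prod_pow_div_factorial
      fun i => |μ i * s i| * (1 + ∑ j, |v i j| * |w j|)).summable.mul_left
        (Real.exp (-M))).mul_right (Real.exp (∑ j, |δ j| * |w j|))
    refine (summable_congr fun x => ?_).mpr h
    rw [hr, abs_mul, Real.abs_exp, Finset.abs_prod, ← mul_assoc,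
      mul_assoc (Real.exp (-M)), ← Finset.prod_mul_distrib]
    congr 2
    refine Finset.prod_congr rfl fun i _ => ?_
    rw [abs_div, abs_pow, Nat.abs_cast, mul_pow _ (1 + _)]
    ring
  have hcoeff := eq_of_hasSum_prod_pow
    (hasSum_tsum_coeff
      (fun x => (HasMajorizedExpansion.exp_linear δ).prod_affine_pow_mul Finset.univ v x)
      hC r hB hF)
    (c' := fun n => Real.exp (∑ i, μ i * (s i - 1)) * ∏ j, A j ^ n j / ((n j).factorial : ℝ))
    fun w => by
      refine ((hasSum_prod_pow_div_factorial fun j => A j * w j).mul_left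
        (Real.exp (∑ i, μ i * (s i - 1)))).congr_fun fun m => ?_
      rw [mul_assoc, ← Finset.prod_mul_distrib]
      congr 1
      exact Finset.prod_congr rfl fun j _ => by rw [mul_pow]; ring
  have hA : ∏ j, A j ^ n j = (1 - ∑ i, (μ i / M) * s i * u 0 i) ^ n 0
      * ∏ j ∈ Finset.univ.erase 0, (∑ i, (μ i / M) * s i * u j i) ^ n j := by
    rw [← Finset.mul_prod_erase _ _ (Finset.mem_univ (0 : Fin d)),
      Finset.prod_congr rfl fun j hj => show A j ^ n j
          = (∑ i, (μ i / M) * s i * u j i) ^ n j by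
        simp only [A, if_neg (Finset.ne_of_mem_erase hj)]]
    simp only [A, if_true]
  refine (congrFun hcoeff n).trans ?_
  rw [Finset.prod_div_distrib, hA]
  ring
end

section
/- The multivariate Meixner polynomials M_n(X;α,θ,p,u), defined as coefficients of w_0^{n_0}⋯w_{d-1}^{n_{d-1}} in (1-w_0)^{-(|X|+α)} Π_{i=1}^d (1 - w_0(1+θ)/θ + Σ_{j=1}^{d-1} u_i^{(j)} w_j)^{X_i}, satisfy the orthogonality E[M_m M_n] = δ_{mn} Γ(|n|+α)/(Γ(α) n_0!⋯n_{d-1}!) ((1+θ)/θ)^{n_0} θ^{|n|-n_0} Π_{j=1}^{d-1} a_j^{n_j}, where X has the multivariate Meixner distribution P(x;α,θ,p). -/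
open Finset

/-- The coefficient of `∏ j, t j ^ n j` in the expansion of `(1 - ∑ j, t j) ^ (-α)`. -/
noncomputable def negMultinomialCoeff {ι : Type*} [Fintype ι] (α : ℝ) (n : ι → ℕ) : ℝ :=
  Real.Gamma ((∑ j, n j : ℕ) + α) / (Real.Gamma α * ∏ j, ((n j).factorial : ℝ))

lemma negMultinomialCoeff_pos {ι : Type*} [Fintype ι] {α : ℝ} (hα : 0 < α) (n : ι → ℕ) :
    0 < negMultinomialCoeff α n := by
  unfold negMultinomialCoeff
  have h1 := Real.Gamma_pos_of_pos hα
  have h2 : 0 < Real.Gamma ((∑ j, n j : ℕ) + α) := Real.Gamma_pos_of_pos (by positivity)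
  positivity

lemma Gamma_nat_add_eq_ascPochhammer_mul {α : ℝ} (hα : 0 < α) (N : ℕ) :
    Real.Gamma (N + α) = (ascPochhammer ℝ N).eval α * Real.Gamma α := by
  induction N with
  | zero => simp
  | succ N ih =>
    rw [Nat.cast_succ, add_right_comm, Real.Gamma_add_one (by positivity), ih,
      ascPochhammer_succ_eval]
    ring

lemma hasSum_one_sub_rpow_neg {α t : ℝ} (hα : 0 < α) (ht : |t| < 1) :
    HasSum (fun N : ℕ => Real.Gamma (N + α) / (Real.Gamma α * N.factorial) * t ^ N)
      ((1 - t) ^ (-α)) := by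
  have h := (Real.one_div_one_sub_rpow_hasFPowerSeriesOnBall_zero α).hasSum (y := t)
    (by rw [← ENNReal.ofReal_one, Metric.eball_ofReal]; simpa using ht)
  have hG := (Real.Gamma_pos_of_pos hα).ne'
  rw [zero_add, one_div, ← Real.rpow_neg (by linarith [le_abs_self t])] at h
  refine h.congr_fun ?_
  intro N
  have hN : (N.factorial : ℝ) ≠ 0 := by positivity
  have := Ring.factorial_nsmul_multichoose_eq_ascPochhammer α N
  rw [Polynomial.ascPochhammer_smeval_eq_eval, Ring.multichoose_eq, nsmul_eq_mul] at this
  rw [FormalMultilinearSeries.ofScalars_apply_eq, smul_eq_mul]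
  congr 1
  rw [Gamma_nat_add_eq_ascPochhammer_mul hα, ← this]
  field_simp

lemma hasSum_negMultinomialCoeff {ι : Type*} [Fintype ι] {α : ℝ} (hα : 0 < α) (t : ι → ℝ)
    (ht : ∑ j, |t j| < 1) :
    HasSum (fun n : ι → ℕ => negMultinomialCoeff α n * ∏ j, t j ^ n j)
      ((1 - ∑ j, t j) ^ (-α)) := by
  classical
  have key : ∀ (s : ι → ℝ) (N : ℕ), HasSum
      (fun n : {n : ι → ℕ // ∑ j, n j = N} => negMultinomialCoeff α n.1 * ∏ j, s j ^ n.1 j)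
      (Real.Gamma (N + α) / (Real.Gamma α * N.factorial) * (∑ j, s j) ^ N) := by
    intro s N
    have h2 := (univ.piAntidiag N).hasSum
      (fun n : ι → ℕ => negMultinomialCoeff α n * ∏ j, s j ^ n j)
    have h3 : (∑ n ∈ univ.piAntidiag N, negMultinomialCoeff α n * ∏ j, s j ^ n j)
        = Real.Gamma (N + α) / (Real.Gamma α * N.factorial) * (∑ j, s j) ^ N := by
      rw [sum_pow_eq_sum_piAntidiag, mul_sum]
      refine sum_congr rfl fun n hn => ?_
      rw [mem_piAntidiag] at hn
      have h4 := Nat.multinomial_spec univ n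
      rw [hn.1] at h4
      have h5 : (∏ j, ((n j).factorial : ℝ)) * Nat.multinomial univ n = N.factorial := by
        exact_mod_cast h4
      have h6 : (Nat.multinomial univ n : ℝ) ≠ 0 := by
        intro h; rw [h] at h5; simp at h5; exact (Nat.factorial_ne_zero N) (by exact_mod_cast h5.symm)
      have h7 : (∏ j, ((n j).factorial : ℝ)) ≠ 0 := by positivity
      rw [negMultinomialCoeff, hn.1, ← h5]
      have hG := (Real.Gamma_pos_of_pos hα).ne'
      field_simp
    rw [h3] at h2
    let e : {n : ι → ℕ // n ∈ univ.piAntidiag N} ≃ {n : ι → ℕ // ∑ j, n j = N} :=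
      Equiv.subtypeEquivRight (by simp [mem_piAntidiag])
    exact e.hasSum_iff.1 h2
  have habs : Summable fun n : ι → ℕ => negMultinomialCoeff α n * ∏ j, |t j| ^ n j := by
    rw [← (Equiv.sigmaFiberEquiv fun n : ι → ℕ => ∑ j, n j).summable_iff]
    rw [summable_sigma_of_nonneg]
    · refine ⟨fun N => (key (fun j => |t j|) N).summable, ?_⟩
      refine (hasSum_one_sub_rpow_neg hα (t := ∑ j, |t j|) ?_).summable.congr ?_
      · rwa [abs_of_nonneg (by positivity)]
      · exact fun N => (key (fun j => |t j|) N).tsum_eq.symm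
    · intro x
      have := negMultinomialCoeff_pos hα (Equiv.sigmaFiberEquiv (fun n : ι → ℕ => ∑ j, n j) x)
      simp only [Function.comp]
      positivity
  have hs : Summable fun n : ι → ℕ => negMultinomialCoeff α n * ∏ j, t j ^ n j := by
    refine Summable.of_norm (habs.congr fun n => ?_)
    simp [abs_of_pos (negMultinomialCoeff_pos hα n)]
  have h1 := ((Equiv.sigmaFiberEquiv fun n : ι → ℕ => ∑ j, n j).hasSum_iff.2 hs.hasSum).sigma
    (fun N => key t N)
  have h2 := h1.unique (hasSum_one_sub_rpow_neg hα ((abs_sum_le_sum_abs _ _).trans_lt ht))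
  exact h2 ▸ hs.hasSum

lemma eq_zero_of_hasSum_zero {c : ℕ → ℝ} {r : ℝ} (hr : 0 < r)
    (h : ∀ w : ℝ, |w| < r → HasSum (fun n => c n * w ^ n) 0) : ∀ n, c n = 0 := by
  have h1 : HasFPowerSeriesAt (0 : ℝ → ℝ) (FormalMultilinearSeries.ofScalars ℝ c) 0 := by
    rw [hasFPowerSeriesAt_iff]
    filter_upwards [Metric.ball_mem_nhds (0 : ℝ) hr] with z hz
    refine (h z (by simpa using hz)).congr_fun fun n => ?_
    simp [FormalMultilinearSeries.coeff_ofScalars, mul_comm]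
  have h2 := h1.eq_zero
  intro n
  have := congrArg (fun q => q.coeff n) h2
  rw [FormalMultilinearSeries.coeff_ofScalars] at this
  exact this

lemma eq_zero_of_hasSum_multi_zero {r : ℝ} (hr : 0 < r) :
    ∀ {d : ℕ} {c : (Fin d → ℕ) → ℝ},
      (∀ w : Fin d → ℝ, (∀ i, |w i| < r) → HasSum (fun n => c n * ∏ i, w i ^ n i) 0) →
      ∀ n, c n = 0
  | 0, c, h, n => by
    have h1 := (h 0 (by simp)).unique (hasSum_unique _)
    rw [univ_eq_empty, prod_empty, mul_one] at h1
    rw [Subsingleton.elim n _]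
    exact h1.symm
  | d + 1, c, h, n => by
    have key : ∀ w : Fin d → ℝ, (∀ i, |w i| < r) → ∀ w₀ : ℝ, |w₀| < r →
        HasSum (fun q : ℕ × (Fin d → ℕ) =>
          c (Fin.cons q.1 q.2) * (w₀ ^ q.1 * ∏ i, w i ^ q.2 i)) 0 := by
      intro w hw w₀ hw₀
      have := h (Fin.cons w₀ w) (by intro i; cases i using Fin.cases <;> simp [hw₀, hw])
      refine ((Fin.consEquiv fun _ => ℕ).hasSum_iff.2 this).congr_fun fun q => ?_
      simp [Fin.consEquiv, Fin.prod_univ_succ]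
    have h0 : ∀ k (n' : Fin d → ℕ), c (Fin.cons k n') = 0 := by
      intro k
      refine eq_zero_of_hasSum_multi_zero hr (c := fun n' => c (Fin.cons k n')) fun w hw => ?_
      have hs : ∀ k, Summable fun n' : Fin d → ℕ => c (Fin.cons k n') * ∏ i, w i ^ n' i := by
        intro k
        have h1 := (key w hw (r / 2) (by rw [abs_of_pos] <;> linarith)).summable.prod_factor k
        have h2 : (r / 2) ^ k ≠ 0 := by positivity
        refine (h1.mul_left ((r / 2) ^ k)⁻¹).congr fun n' => ?_
        field_simp
      have h2 : ∀ k, (∑' n' : Fin d → ℕ, c (Fin.cons k n') * ∏ i, w i ^ n' i) = 0 := by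
        refine eq_zero_of_hasSum_zero hr fun w₀ hw₀ => ?_
        refine (key w hw w₀ hw₀).prod_fiberwise fun k => ?_
        refine ((hs k).hasSum.mul_right (w₀ ^ k)).congr_fun fun n' => ?_
        ring
      exact h2 k ▸ (hs k).hasSum
    rw [← Fin.cons_self_tail n]
    exact h0 _ _

/-- On the polydisc of radius `r` the function `f` is the sum of a power series whose absolute
values at radius `r` add up to at most `B`. -/
def HasBoundedExpansion {ι : Type*} [Fintype ι] (r : ℝ) (f : (ι → ℝ) → ℝ) (B : ℝ) : Prop :=
  ∃ c : (ι → ℕ) → ℝ,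
    (∀ w : ι → ℝ, (∀ i, |w i| ≤ r) → HasSum (fun n => c n * ∏ i, w i ^ n i) (f w)) ∧
    ∃ S ≤ B, HasSum (fun n => |c n| * ∏ i, r ^ n i) S

namespace HasBoundedExpansion

variable {ι : Type*} [Fintype ι] {r : ℝ}

lemma of_family {T : Type*} (hr : 0 < r) {b : T → ℝ} {e : T → ι → ℕ} {f : (ι → ℝ) → ℝ} {B : ℝ}
    (hf : ∀ w : ι → ℝ, (∀ i, |w i| ≤ r) → HasSum (fun t => b t * ∏ i, w i ^ e t i) (f w))
    (hB : HasSum (fun t => |b t| * ∏ i, r ^ e t i) B) : HasBoundedExpansion r f B := by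
  have hB' := (Equiv.sigmaFiberEquiv e).hasSum_iff.2 hB
  have hfib : ∀ n : ι → ℕ, Summable fun t : {t // e t = n} => |b t.1| := by
    intro n
    have h1 := hB'.summable.sigma_factor n
    have h2 : (∏ i, r ^ n i) ≠ 0 := by positivity
    refine (h1.mul_right (∏ i, r ^ n i)⁻¹).congr ?_
    rintro ⟨t, rfl⟩
    simp only [Function.comp, Equiv.sigmaFiberEquiv_apply]
    field_simp
  have hfib' : ∀ n : ι → ℕ, Summable fun t : {t // e t = n} => b t.1 := fun n =>
    Summable.of_norm (hfib n)
  have hS := hB'.sigma (g := fun n => (∑' t : {t // e t = n}, |b t.1|) * ∏ i, r ^ n i) (by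
    intro n
    refine ((hfib n).hasSum.mul_right (∏ i, r ^ n i)).congr_fun ?_
    rintro ⟨t, rfl⟩
    rfl)
  have hle : ∀ n : ι → ℕ, |∑' t : {t // e t = n}, b t.1| * ∏ i, r ^ n i
      ≤ (∑' t : {t // e t = n}, |b t.1|) * ∏ i, r ^ n i := by
    intro n
    gcongr
    exact norm_tsum_le_tsum_norm (f := fun t : {t // e t = n} => b t.1) (hfib n)
  have hs := Summable.of_nonneg_of_le (fun n => by positivity) hle hS.summable
  refine ⟨fun n => ∑' t : {t // e t = n}, b t.1, fun w hw => ?_, _, ?_, hs.hasSum⟩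
  · refine ((Equiv.sigmaFiberEquiv e).hasSum_iff.2 (hf w hw)).sigma fun n => ?_
    refine ((hfib' n).hasSum.mul_right (∏ i, w i ^ n i)).congr_fun ?_
    rintro ⟨t, rfl⟩
    rfl
  · exact hasSum_le hle hs.hasSum hS

lemma nonneg (hr : 0 < r) {f : (ι → ℝ) → ℝ} {B : ℝ} (h : HasBoundedExpansion r f B) : 0 ≤ B := by
  obtain ⟨c, -, S, hS, h⟩ := h
  exact (h.nonneg fun n => by positivity).trans hS

lemma mono {f : (ι → ℝ) → ℝ} {B B' : ℝ} (h : HasBoundedExpansion r f B) (hB : B ≤ B') :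
    HasBoundedExpansion r f B' := by
  obtain ⟨c, h1, S, hS, h2⟩ := h
  exact ⟨c, h1, S, hS.trans hB, h2⟩

lemma mul (hr : 0 < r) {f g : (ι → ℝ) → ℝ} {B B' : ℝ} (hf : HasBoundedExpansion r f B)
    (hg : HasBoundedExpansion r g B') : HasBoundedExpansion r (fun w => f w * g w) (B * B') := by
  have hB := hf.nonneg hr
  obtain ⟨c, h1, S, hS, h2⟩ := hf
  obtain ⟨c', h1', S', hS', h2'⟩ := hg
  have hS0 : 0 ≤ S' := h2'.nonneg fun n => by positivity
  have hsum := h2.summable.mul_of_nonneg h2'.summable (fun n => by positivity)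
    (fun n => by positivity)
  have hT := h2.mul h2' hsum
  refine mono (of_family (T := (ι → ℕ) × (ι → ℕ)) hr (b := fun t => c t.1 * c' t.2)
    (e := fun t => t.1 + t.2) (fun w hw => ?_) (B := S * S') ?_) (by gcongr)
  · have habs : ∀ (k : (ι → ℕ) → ℝ), (Summable fun n => |k n| * ∏ i, r ^ n i) →
        Summable fun n => ‖k n * ∏ i, w i ^ n i‖ := by
      intro k hk
      refine Summable.of_nonneg_of_le (fun n => norm_nonneg _) (fun n => ?_) hk
      rw [Real.norm_eq_abs, abs_mul, abs_prod]
      gcongr with i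
      rw [abs_pow]
      gcongr
      exact hw i
    refine ((h1 w hw).mul (h1' w hw) (summable_mul_of_summable_norm
      (habs c h2.summable) (habs c' h2'.summable))).congr_fun fun t => ?_
    simp only [Pi.add_apply, pow_add, prod_mul_distrib]
    ring
  · refine hT.congr_fun fun t => ?_
    simp only [Pi.add_apply, pow_add, prod_mul_distrib, abs_mul]
    ring

lemma add {f g : (ι → ℝ) → ℝ} {B B' : ℝ} (hr : 0 < r) (hf : HasBoundedExpansion r f B)
    (hg : HasBoundedExpansion r g B') : HasBoundedExpansion r (fun w => f w + g w) (B + B') := by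
  obtain ⟨c, h1, S, hS, h2⟩ := hf
  obtain ⟨c', h1', S', hS', h2'⟩ := hg
  have hle : ∀ n : ι → ℕ, |c n + c' n| * ∏ i, r ^ n i
      ≤ |c n| * ∏ i, r ^ n i + |c' n| * ∏ i, r ^ n i := by
    intro n
    rw [← add_mul]
    gcongr
    exact abs_add_le _ _
  have hs := Summable.of_nonneg_of_le (fun n => by positivity) hle (h2.add h2').summable
  refine ⟨fun n => c n + c' n, fun w hw => ?_, _, ?_, hs.hasSum⟩
  · refine ((h1 w hw).add (h1' w hw)).congr_fun fun n => by ring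
  · exact (hasSum_le hle hs.hasSum (h2.add h2')).trans (by gcongr)

lemma const (hr : 0 < r) (v : ℝ) : HasBoundedExpansion (ι := ι) r (fun _ => v) |v| := by
  refine of_family (T := Unit) hr (b := fun _ => v) (e := fun _ => 0) (fun w _ => ?_) ?_
  · simp
  · simp

lemma coord [DecidableEq ι] (hr : 0 < r) (i : ι) :
    HasBoundedExpansion (ι := ι) r (fun w => w i) r := by
  refine of_family (T := Unit) hr (b := fun _ => 1) (e := fun _ => Pi.single i 1)
    (fun w _ => ?_) ?_
  · simp [Pi.single_apply, pow_ite]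
  · simp [Pi.single_apply, pow_ite]

lemma pow (hr : 0 < r) {f : (ι → ℝ) → ℝ} {B : ℝ} (hf : HasBoundedExpansion r f B) (k : ℕ) :
    HasBoundedExpansion r (fun w => f w ^ k) (B ^ k) := by
  induction k with
  | zero => simpa using const hr 1
  | succ k ih => simpa [pow_succ] using ih.mul hr hf

lemma sum {κ : Type*} (hr : 0 < r) (s : Finset κ) {f : κ → (ι → ℝ) → ℝ} {B : κ → ℝ}
    (hf : ∀ k ∈ s, HasBoundedExpansion r (f k) (B k)) :
    HasBoundedExpansion r (fun w => ∑ k ∈ s, f k w) (∑ k ∈ s, B k) := by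
  classical
  induction s using Finset.induction_on with
  | empty => simpa using const hr 0
  | insert k s hk ih =>
    simp only [sum_insert hk]
    exact (hf k (mem_insert_self k s)).add hr (ih fun j hj => hf j (mem_insert_of_mem hj))

lemma prod {κ : Type*} (hr : 0 < r) (s : Finset κ) {f : κ → (ι → ℝ) → ℝ} {B : κ → ℝ}
    (hf : ∀ k ∈ s, HasBoundedExpansion r (f k) (B k)) :
    HasBoundedExpansion r (fun w => ∏ k ∈ s, f k w) (∏ k ∈ s, B k) := by
  classical
  induction s using Finset.induction_on with
  | empty => simpa using const hr 1
  | insert k s hk ih =>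
    simp only [prod_insert hk]
    exact (hf k (mem_insert_self k s)).mul hr (ih fun j hj => hf j (mem_insert_of_mem hj))

lemma one_sub_rpow_neg [DecidableEq ι] (hr : 0 < r) (hr1 : r < 1) {β : ℝ} (hβ : 0 < β) (i : ι) :
    HasBoundedExpansion (ι := ι) r (fun w => (1 - w i) ^ (-β)) ((1 - r) ^ (-β)) := by
  refine of_family (T := ℕ) hr (b := fun N => Real.Gamma (N + β) / (Real.Gamma β * N.factorial))
    (e := fun N => Pi.single i N) (fun w hw => ?_) ?_
  · simpa [Pi.single_apply, pow_ite] using hasSum_one_sub_rpow_neg hβ ((hw i).trans_lt hr1)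
  · refine (hasSum_one_sub_rpow_neg hβ (t := r) (by rwa [abs_of_pos hr])).congr_fun fun N => ?_
    have h1 := Real.Gamma_pos_of_pos hβ
    have h2 : 0 < Real.Gamma (N + β) := Real.Gamma_pos_of_pos (by positivity)
    rw [abs_of_nonneg (by positivity)]
    simp [Pi.single_apply, pow_ite]

end HasBoundedExpansion

lemma hasSum_tsum_mul {X I : Type*} {W : X → ℝ} (hW : ∀ x, 0 ≤ W x) {A B R : I → X → ℝ}
    (hA : ∀ m x, |A m x| ≤ R m x) (hB : ∀ m x, |B m x| ≤ R m x) {S : X → ℝ}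
    (hS : ∀ x, HasSum (fun m => R m x) (S x)) (hWS : Summable fun x => W x * (S x * S x))
    {F G : X → ℝ} (hF : ∀ x, HasSum (fun m => A m x) (F x))
    (hG : ∀ x, HasSum (fun m => B m x) (G x)) {V : ℝ}
    (hV : HasSum (fun x => W x * (F x * G x)) V) :
    HasSum (fun q : I × I => ∑' x, W x * (A q.1 x * B q.2 x)) V := by
  have hR : ∀ m x, 0 ≤ R m x := fun m x => (abs_nonneg _).trans (hA m x)
  have h1 : ∀ x, HasSum (fun q : I × I => W x * (R q.1 x * R q.2 x)) (W x * (S x * S x)) := by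
    intro x
    exact ((hS x).mul (hS x) ((hS x).summable.mul_of_nonneg (hS x).summable
      (fun m => hR m x) (fun m => hR m x))).mul_left (W x)
  have h2 : Summable fun q : X × (I × I) => W q.1 * (R q.2.1 q.1 * R q.2.2 q.1) := by
    rw [summable_prod_of_nonneg (fun q => mul_nonneg (hW _) (mul_nonneg (hR _ _) (hR _ _)))]
    exact ⟨fun x => (h1 x).summable, hWS.congr fun x => (h1 x).tsum_eq.symm⟩
  have h3 : Summable fun q : X × (I × I) => W q.1 * (A q.2.1 q.1 * B q.2.2 q.1) := by
    refine Summable.of_norm_bounded h2 fun q => ?_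
    rw [Real.norm_eq_abs, abs_mul, abs_mul, abs_of_nonneg (hW _)]
    exact mul_le_mul_of_nonneg_left (mul_le_mul (hA _ _) (hB _ _) (abs_nonneg _) (hR _ _)) (hW _)
  have h4 : ∀ x, HasSum (fun q : I × I => W x * (A q.1 x * B q.2 x)) (W x * (F x * G x)) := by
    intro x
    have hAs : Summable fun m => ‖A m x‖ :=
      Summable.of_nonneg_of_le (fun m => norm_nonneg _) (fun m => hA m x) (hS x).summable
    have hBs : Summable fun m => ‖B m x‖ :=
      Summable.of_nonneg_of_le (fun m => norm_nonneg _) (fun m => hB m x) (hS x).summable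
    exact ((hF x).mul (hG x) (summable_mul_of_summable_norm hAs hBs)).mul_left (W x)
  have h5 := h3.hasSum
  rw [(h5.prod_fiberwise h4).unique hV] at h5
  have h6 := (Equiv.prodComm (I × I) X).hasSum_iff.2 h5
  exact h6.prod_fiberwise fun q => (h6.summable.prod_factor q).hasSum

lemma eq_of_hasSum_prod {d : ℕ} {r : ℝ} (hr : 0 < r) {c c' : (Fin d → ℕ) → (Fin d → ℕ) → ℝ}
    {V : (Fin d → ℝ) → (Fin d → ℝ) → ℝ}
    (h : ∀ w z : Fin d → ℝ, (∀ i, |w i| < r) → (∀ i, |z i| < r) →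
      HasSum (fun q : (Fin d → ℕ) × (Fin d → ℕ) =>
        c q.1 q.2 * ((∏ i, w i ^ q.1 i) * ∏ i, z i ^ q.2 i)) (V w z))
    (h' : ∀ w z : Fin d → ℝ, (∀ i, |w i| < r) → (∀ i, |z i| < r) →
      HasSum (fun q : (Fin d → ℕ) × (Fin d → ℕ) =>
        c' q.1 q.2 * ((∏ i, w i ^ q.1 i) * ∏ i, z i ^ q.2 i)) (V w z))
    (m n : Fin d → ℕ) : c m n = c' m n := by
  have key := eq_zero_of_hasSum_multi_zero hr (d := d + d)
    (c := fun k => c (fun i => k (Fin.castAdd d i)) (fun i => k (Fin.natAdd d i))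
      - c' (fun i => k (Fin.castAdd d i)) (fun i => k (Fin.natAdd d i)))
    (fun w hw => by
      have h1 := (h (fun i => w (Fin.castAdd d i)) (fun i => w (Fin.natAdd d i))
        (fun i => hw _) (fun i => hw _)).sub
        (h' (fun i => w (Fin.castAdd d i)) (fun i => w (Fin.natAdd d i))
        (fun i => hw _) (fun i => hw _))
      rw [sub_self] at h1
      refine ((Fin.appendEquiv d d).symm.hasSum_iff.2 h1).congr_fun fun k => ?_
      simp only [Function.comp, Fin.prod_univ_add, Fin.appendEquiv, Equiv.coe_fn_symm_mk]
      ring)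
    (Fin.append m n)
  simpa only [Fin.append_left, Fin.append_right, sub_eq_zero] using key

/-- The affine form raised to the power `x i` in the generating function of the multivariate
Meixner polynomials. -/
noncomputable def meixnerForm {d : ℕ} [NeZero d] (θ : ℝ) (u : Fin d → Fin d → ℝ) (i : Fin d)
    (w : Fin d → ℝ) : ℝ :=
  1 - w 0 * (1 + θ) / θ + ∑ j ∈ univ.erase 0, u j i * w j

/-- The generating function of the multivariate Meixner polynomials. -/
noncomputable def meixnerGenFun {d : ℕ} [NeZero d] (α θ : ℝ) (u : Fin d → Fin d → ℝ)
    (x : Fin d → ℕ) (w : Fin d → ℝ) : ℝ :=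
  (1 - w 0) ^ (-((∑ i, x i : ℝ) + α)) * ∏ i, meixnerForm θ u i w ^ x i

/-- The probability mass function of the multivariate Meixner distribution. -/
noncomputable def meixnerWeight {d : ℕ} (α θ : ℝ) (p : Fin d → ℝ) (x : Fin d → ℕ) : ℝ :=
  (1 + θ) ^ (-α) * (negMultinomialCoeff α x * ∏ i, (θ / (1 + θ) * p i) ^ x i)

/-- The coefficients of the bilinear form in the expected product of two generating functions. -/
noncomputable def meixnerNorm {d : ℕ} [NeZero d] (θ : ℝ) (a : Fin d → ℝ) (j : Fin d) : ℝ :=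
  if j = 0 then (1 + θ) / θ else θ * a j

section Meixner

variable {d : ℕ} {α θ : ℝ} {u : Fin d → Fin d → ℝ} {p a : Fin d → ℝ}

/-- A constant with `|meixnerForm θ u i w| ≤ 1 + meixnerSlope θ u * r` on the polydisc of
radius `r`. -/
noncomputable def meixnerSlope (θ : ℝ) (u : Fin d → Fin d → ℝ) : ℝ :=
  (1 + θ) / θ + ∑ i, ∑ j, |u j i|

lemma meixnerSlope_pos (hθ : 0 < θ) : 0 < meixnerSlope θ u := by
  unfold meixnerSlope; positivity

lemma meixnerWeight_nonneg (hα : 0 < α) (hθ : 0 < θ) (hp : ∀ i, 0 < p i) (x : Fin d → ℕ) :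
    0 ≤ meixnerWeight α θ p x := by
  have h1 := negMultinomialCoeff_pos hα x
  have h2 : 0 ≤ ∏ i, (θ / (1 + θ) * p i) ^ x i :=
    prod_nonneg fun i _ => pow_nonneg (mul_nonneg (by positivity) (hp i).le) _
  unfold meixnerWeight
  positivity

lemma meixnerWeight_eq (hα : 0 < α) (hθ : 0 < θ) (x : Fin d → ℕ) :
    Real.Gamma (α + ∑ i, x i) / (Real.Gamma α * (∑ i, x i).factorial)
      * θ ^ (∑ i, x i) / (1 + θ) ^ (α + ∑ i, x i)
      * ((∑ i, x i).factorial / ∏ i, ((x i).factorial : ℝ)) * (∏ i, p i ^ x i)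
      = meixnerWeight α θ p x := by
  have h1 : 0 < 1 + θ := by linarith
  have h2 := (Real.Gamma_pos_of_pos hα).ne'
  rw [meixnerWeight, negMultinomialCoeff, Real.rpow_neg h1.le, Real.rpow_add h1, Real.rpow_natCast,
    add_comm α]
  simp only [mul_pow, prod_mul_distrib, div_pow, prod_div_distrib, prod_pow_eq_pow_sum]
  have h3 : (∏ i, ((x i).factorial : ℝ)) ≠ 0 := by positivity
  have h4 : ((∑ i, x i).factorial : ℝ) ≠ 0 := by positivity
  field_simp

lemma hasSum_meixnerWeight_mul_pow (hα : 0 < α) (hθ : 0 < θ) (c : Fin d → ℝ)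
    (hc : ∑ i, |θ / (1 + θ) * p i * c i| < 1) :
    HasSum (fun x => meixnerWeight α θ p x * ∏ i, c i ^ x i)
      ((1 + θ - θ * ∑ i, p i * c i) ^ (-α)) := by
  have h1 := (hasSum_negMultinomialCoeff hα _ hc).mul_left ((1 + θ) ^ (-α))
  have h2 : ∑ i, θ / (1 + θ) * p i * c i < 1 :=
    (le_abs_self _).trans_lt ((abs_sum_le_sum_abs _ _).trans_lt hc)
  rw [← Real.mul_rpow (by positivity) (by linarith)] at h1
  convert! h1 using 2 with x
  · simp only [meixnerWeight, mul_pow, prod_mul_distrib]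
    ring
  · simp only [mul_assoc, ← mul_sum]
    field_simp

variable [NeZero d]

lemma one_add_mul_add_sum_le {r : ℝ} (hr : 0 < r) (i : Fin d) :
    (1 + r * ((1 + θ) / θ)) + ∑ j ∈ univ.erase 0, |u j i| * r ≤ 1 + meixnerSlope θ u * r := by
  have h1 : ∑ j ∈ univ.erase 0, |u j i| ≤ ∑ i, ∑ j, |u j i| :=
    (sum_le_sum_of_subset_of_nonneg (erase_subset _ _) fun _ _ _ => abs_nonneg _).trans
      (single_le_sum (f := fun i => ∑ j, |u j i|) (fun i _ => by positivity) (mem_univ i))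
  rw [← sum_mul, meixnerSlope]
  nlinarith [mul_le_mul_of_nonneg_right h1 hr.le]

lemma abs_meixnerForm_le (hθ : 0 < θ) {r : ℝ} (hr : 0 < r) {w : Fin d → ℝ} (hw : ∀ i, |w i| < r)
    (i : Fin d) : |meixnerForm θ u i w| ≤ 1 + meixnerSlope θ u * r := by
  refine le_trans ?_ (one_add_mul_add_sum_le hr i)
  have h1 : |w 0 * (1 + θ) / θ| ≤ r * ((1 + θ) / θ) := by
    rw [mul_div_assoc, abs_mul, abs_of_pos (a := (1 + θ) / θ) (by positivity)]
    gcongr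
    exact (hw 0).le
  have h2 : |∑ j ∈ univ.erase 0, u j i * w j| ≤ ∑ j ∈ univ.erase 0, |u j i| * r := by
    refine (abs_sum_le_sum_abs _ _).trans (sum_le_sum fun j _ => ?_)
    rw [abs_mul]
    gcongr
    exact (hw j).le
  unfold meixnerForm
  refine (abs_add_le _ _).trans (add_le_add ((abs_sub _ _).trans ?_) h2)
  rw [abs_one]
  gcongr

lemma hasBoundedExpansion_meixnerForm (hθ : 0 < θ) {r : ℝ} (hr : 0 < r) (i : Fin d) :
    HasBoundedExpansion r (meixnerForm θ u i) (1 + meixnerSlope θ u * r) := by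
  have h1 := ((HasBoundedExpansion.coord hr (0 : Fin d)).mul hr
    (HasBoundedExpansion.const hr (-((1 + θ) / θ))))
  have h2 := HasBoundedExpansion.sum hr (univ.erase (0 : Fin d)) fun j _ =>
    (HasBoundedExpansion.const hr (u j i)).mul hr (HasBoundedExpansion.coord hr j)
  have h3 := ((HasBoundedExpansion.const hr 1).add hr h1).add hr h2
  rw [abs_one, abs_neg, abs_of_pos (by positivity)] at h3
  refine (funext fun w => ?_ : meixnerForm θ u i = _) ▸ h3.mono (one_add_mul_add_sum_le hr i)
  unfold meixnerForm
  ring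

lemma hasBoundedExpansion_meixnerGenFun (hα : 0 < α) (hθ : 0 < θ) {r : ℝ} (hr : 0 < r)
    (hr1 : r < 1) (x : Fin d → ℕ) :
    HasBoundedExpansion r (meixnerGenFun α θ u x)
      ((1 - r) ^ (-α) * ((1 + meixnerSlope θ u * r) / (1 - r)) ^ ∑ i, x i) := by
  have h1 := (HasBoundedExpansion.one_sub_rpow_neg hr hr1
    (β := (∑ i, x i : ℝ) + α) (by positivity) (0 : Fin d)).mul hr
    (HasBoundedExpansion.prod hr univ fun i _ =>
      (hasBoundedExpansion_meixnerForm (u := u) hθ hr i).pow hr (x i))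
  refine h1.mono (le_of_eq ?_)
  have h2 : 0 < 1 - r := by linarith
  rw [prod_pow_eq_pow_sum, div_pow, neg_add, Real.rpow_add h2, ← Nat.cast_sum, Real.rpow_neg h2.le,
    Real.rpow_natCast]
  field_simp

lemma meixnerGenFun_expansion_bound (hα : 0 < α) (hθ : 0 < θ) {x : Fin d → ℕ}
    {c : (Fin d → ℕ) → ℝ}
    (hc : ∀ w : Fin d → ℝ, |w 0| < 1 →
      HasSum (fun n => c n * ∏ j, w j ^ n j) (meixnerGenFun α θ u x w))
    {r : ℝ} (hr : 0 < r) (hr1 : r < 1) :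
    ∃ S ≤ (1 - r) ^ (-α) * ((1 + meixnerSlope θ u * r) / (1 - r)) ^ ∑ i, x i,
      HasSum (fun n => |c n| * ∏ j, r ^ n j) S := by
  obtain ⟨c', h1, h2⟩ := hasBoundedExpansion_meixnerGenFun (u := u) hα hθ hr hr1 x
  have h3 : ∀ n, c n - c' n = 0 := eq_zero_of_hasSum_multi_zero hr fun w hw => by
    have := (hc w ((hw 0).trans hr1)).sub (h1 w fun i => (hw i).le)
    rw [sub_self] at this
    exact this.congr_fun fun n => by ring
  have h4 : c = c' := funext fun n => sub_eq_zero.1 (h3 n)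
  rwa [h4]

lemma meixnerGenFun_mul {w z : Fin d → ℝ} (hw : |w 0| < 1) (hz : |z 0| < 1) (x : Fin d → ℕ) :
    meixnerGenFun α θ u x w * meixnerGenFun α θ u x z
      = ((1 - w 0) * (1 - z 0)) ^ (-α)
        * ∏ i, (meixnerForm θ u i w * meixnerForm θ u i z / ((1 - w 0) * (1 - z 0))) ^ x i := by
  have h1 : 0 < 1 - w 0 := by linarith [le_abs_self (w 0)]
  have h2 : 0 < 1 - z 0 := by linarith [le_abs_self (z 0)]
  simp only [meixnerGenFun, div_pow, mul_pow, prod_div_distrib, prod_mul_distrib,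
    prod_pow_eq_pow_sum]
  rw [Real.mul_rpow h1.le h2.le, neg_add, Real.rpow_add h1, Real.rpow_add h2, ← Nat.cast_sum,
    Real.rpow_neg h1.le (_ : ℕ), Real.rpow_neg h2.le (_ : ℕ), Real.rpow_natCast, Real.rpow_natCast]
  field_simp

lemma sum_mul_meixnerForm_mul (hpsum : ∑ i, p i = 1) (hu0 : ∀ i, u 0 i = 1)
    (horth : ∀ k l, ∑ i, u k i * u l i * p i = if k = l then a k else 0) (w z : Fin d → ℝ) :
    ∑ i, p i * (meixnerForm θ u i w * meixnerForm θ u i z)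
      = (1 - w 0 * (1 + θ) / θ) * (1 - z 0 * (1 + θ) / θ)
        + ∑ j ∈ univ.erase 0, a j * (w j * z j) := by
  have h0 : ∀ v : Fin d → ℝ, ∑ i, p i * ∑ j ∈ univ.erase 0, u j i * v j = 0 := by
    intro v
    simp only [mul_sum]
    rw [sum_comm]
    refine sum_eq_zero fun j hj => ?_
    have h1 := horth j 0
    rw [if_neg (ne_of_mem_erase hj)] at h1
    simp only [hu0, mul_one] at h1
    calc ∑ i, p i * (u j i * v j) = (∑ i, u j i * p i) * v j := by
          rw [sum_mul]; exact sum_congr rfl fun i _ => by ring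
      _ = 0 := by rw [h1, zero_mul]
  have h1 : ∑ i, p i * ((∑ j ∈ univ.erase 0, u j i * w j) * ∑ k ∈ univ.erase 0, u k i * z k)
      = ∑ j ∈ univ.erase 0, a j * (w j * z j) := by
    simp only [sum_mul_sum]
    simp only [mul_sum]
    rw [sum_comm]
    refine sum_congr rfl fun j hj => ?_
    rw [sum_comm]
    have h2 : ∀ k, ∑ i, p i * (u j i * w j * (u k i * z k))
        = (if j = k then a j else 0) * (w j * z k) := by
      intro k
      rw [← horth, sum_mul]
      exact sum_congr rfl fun i _ => by ring
    simp only [h2, ite_mul, zero_mul]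
    rw [sum_ite_eq, if_pos hj]
  calc ∑ i, p i * (meixnerForm θ u i w * meixnerForm θ u i z)
      = ∑ i, (p i * ((1 - w 0 * (1 + θ) / θ) * (1 - z 0 * (1 + θ) / θ))
        + (1 - w 0 * (1 + θ) / θ) * (p i * ∑ j ∈ univ.erase 0, u j i * z j)
        + (1 - z 0 * (1 + θ) / θ) * (p i * ∑ j ∈ univ.erase 0, u j i * w j)
        + p i * ((∑ j ∈ univ.erase 0, u j i * w j) * ∑ k ∈ univ.erase 0, u k i * z k)) :=
        sum_congr rfl fun i _ => by unfold meixnerForm; ring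
    _ = _ := by
        rw [sum_add_distrib, sum_add_distrib, sum_add_distrib, ← sum_mul, ← mul_sum, ← mul_sum,
          h0, h0, h1, hpsum]
        ring

/-- The radius `r` is so small that all interchanges of summation are justified on the polydisc
of radius `r`. -/
structure IsSmallRadius (θ : ℝ) (u : Fin d → Fin d → ℝ) (a : Fin d → ℝ) (r : ℝ) : Prop where
  pos : 0 < r
  lt_one : r < 1
  ratio : θ / (1 + θ) * ((1 + meixnerSlope θ u * r) / (1 - r)) ^ 2 < 1
  norm : ∑ j, |meixnerNorm θ a j| * r ^ 2 < 1

lemma exists_isSmallRadius (hθ : 0 < θ) (u : Fin d → Fin d → ℝ) (a : Fin d → ℝ) :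
    ∃ r, IsSmallRadius θ u a r := by
  have h1 : ContinuousAt (fun r : ℝ => θ / (1 + θ) * ((1 + meixnerSlope θ u * r) / (1 - r)) ^ 2)
      0 := by
    refine continuousAt_const.mul (ContinuousAt.pow (ContinuousAt.div ?_ ?_ ?_) 2)
    · fun_prop
    · fun_prop
    · simp
  have h2 : Continuous (fun r : ℝ => ∑ j, |meixnerNorm θ a j| * r ^ 2) := by fun_prop
  have e1 := h1.eventually_lt_const (u := 1) (by
    simp only [mul_zero, add_zero, sub_zero, div_one, one_pow, mul_one]
    rw [div_lt_one (by positivity)]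
    linarith)
  have e2 := (h2.tendsto 0).eventually_lt_const (u := 1) (by simp)
  have e3 : ∀ᶠ r : ℝ in nhds 0, r < 1 := eventually_lt_nhds one_pos
  obtain ⟨r, ⟨h1, h2, h3⟩, h4⟩ := (((e1.and (e2.and e3)).filter_mono nhdsWithin_le_nhds).and
    (self_mem_nhdsWithin (s := Set.Ioi (0 : ℝ)))).exists
  exact ⟨r, h4, h3, h1, h2⟩

lemma sum_abs_ratio_lt_one (hθ : 0 < θ) (hp : ∀ i, 0 < p i) (hpsum : ∑ i, p i = 1) {r : ℝ}
    (hr : IsSmallRadius θ u a r) {c : Fin d → ℝ}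
    (hc : ∀ i, |c i| ≤ ((1 + meixnerSlope θ u * r) / (1 - r)) ^ 2) :
    ∑ i, |θ / (1 + θ) * p i * c i| < 1 := by
  refine lt_of_le_of_lt ?_ hr.ratio
  calc ∑ i, |θ / (1 + θ) * p i * c i|
      ≤ ∑ i, p i * (θ / (1 + θ) * ((1 + meixnerSlope θ u * r) / (1 - r)) ^ 2) := by
        refine sum_le_sum fun i _ => ?_
        rw [abs_mul, abs_mul, abs_of_pos (hp i), abs_of_pos (a := θ / (1 + θ)) (by positivity),
          mul_comm (θ / (1 + θ)), mul_assoc]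
        have := hp i
        gcongr
        exact hc i
    _ = _ := by rw [← sum_mul, hpsum, one_mul]

lemma hasSum_meixnerWeight_mul_genFun (hα : 0 < α) (hθ : 0 < θ) (hp : ∀ i, 0 < p i)
    (hpsum : ∑ i, p i = 1) (hu0 : ∀ i, u 0 i = 1)
    (horth : ∀ k l, ∑ i, u k i * u l i * p i = if k = l then a k else 0) {r : ℝ}
    (hr : IsSmallRadius θ u a r) {w z : Fin d → ℝ} (hw : ∀ i, |w i| < r) (hz : ∀ i, |z i| < r) :
    HasSum (fun x => meixnerWeight α θ p x * (meixnerGenFun α θ u x w * meixnerGenFun α θ u x z))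
      ((1 - ∑ j, meixnerNorm θ a j * (w j * z j)) ^ (-α)) := by
  have hr0 := hr.pos
  have hr1 : 0 < 1 - r := by linarith [hr.lt_one]
  have hw0 : 1 - r < 1 - w 0 := by linarith [le_abs_self (w 0), hw 0]
  have hz0 : 1 - r < 1 - z 0 := by linarith [le_abs_self (z 0), hz 0]
  have hw1 := hr1.trans hw0
  have hz1 := hr1.trans hz0
  have hC := meixnerSlope_pos (u := u) hθ
  have hc : ∑ i, |θ / (1 + θ) * p i *
      (meixnerForm θ u i w * meixnerForm θ u i z / ((1 - w 0) * (1 - z 0)))| < 1 := by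
    refine sum_abs_ratio_lt_one hθ hp hpsum hr fun i => ?_
    rw [abs_div, abs_mul, abs_of_pos (a := (1 - w 0) * (1 - z 0)) (by positivity), div_pow, sq, sq]
    gcongr
    · exact abs_meixnerForm_le hθ hr0 hw i
    · exact abs_meixnerForm_le hθ hr0 hz i
  have h1 := (hasSum_meixnerWeight_mul_pow hα hθ _ hc).mul_left (((1 - w 0) * (1 - z 0)) ^ (-α))
  have h2 : ∑ i, p i * (meixnerForm θ u i w * meixnerForm θ u i z / ((1 - w 0) * (1 - z 0)))
      = ((1 - w 0 * (1 + θ) / θ) * (1 - z 0 * (1 + θ) / θ)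
        + ∑ j ∈ univ.erase 0, a j * (w j * z j)) / ((1 - w 0) * (1 - z 0)) := by
    rw [← sum_mul_meixnerForm_mul hpsum hu0 horth, sum_div]
    exact sum_congr rfl fun i _ => (mul_div_assoc _ _ _).symm
  have h3 : 0 ≤ 1 + θ - θ * ∑ i, p i *
      (meixnerForm θ u i w * meixnerForm θ u i z / ((1 - w 0) * (1 - z 0))) := by
    have h4 := (le_abs_self _).trans_lt ((abs_sum_le_sum_abs _ _).trans_lt hc)
    simp only [mul_assoc, ← mul_sum] at h4
    rw [div_mul_eq_mul_div, div_lt_one (by positivity)] at h4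
    simp only [mul_div_assoc] at h4 ⊢
    linarith
  rw [← Real.mul_rpow (by positivity) h3, h2] at h1
  have h4 : (1 - w 0) * (1 - z 0) * (1 + θ - θ * (((1 - w 0 * (1 + θ) / θ)
        * (1 - z 0 * (1 + θ) / θ) + ∑ j ∈ univ.erase 0, a j * (w j * z j))
        / ((1 - w 0) * (1 - z 0))))
      = 1 - ∑ j, meixnerNorm θ a j * (w j * z j) := by
    have h5 : ∑ j ∈ univ.erase 0, meixnerNorm θ a j * (w j * z j)
        = θ * ∑ j ∈ univ.erase 0, a j * (w j * z j) := by
      rw [mul_sum]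
      refine sum_congr rfl fun j hj => ?_
      rw [meixnerNorm, if_neg (ne_of_mem_erase hj), mul_assoc]
    rw [← add_sum_erase _ _ (mem_univ (0 : Fin d)), h5, meixnerNorm, if_pos rfl]
    field_simp
    ring
  rw [h4] at h1
  refine h1.congr_fun fun x => ?_
  rw [meixnerGenFun_mul (by linarith [hw 0]) (by linarith [hz 0])]
  ring

lemma hasSum_diagonal (hα : 0 < α) {r : ℝ} (hr : IsSmallRadius θ u a r) {w z : Fin d → ℝ}
    (hw : ∀ i, |w i| < r) (hz : ∀ i, |z i| < r) :
    HasSum (fun q : (Fin d → ℕ) × (Fin d → ℕ) =>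
      (if q.1 = q.2 then negMultinomialCoeff α q.2 * ∏ j, meixnerNorm θ a j ^ q.2 j else 0)
        * ((∏ i, w i ^ q.1 i) * ∏ i, z i ^ q.2 i))
      ((1 - ∑ j, meixnerNorm θ a j * (w j * z j)) ^ (-α)) := by
  have hr0 := hr.pos
  have h1 := hasSum_negMultinomialCoeff hα (fun j => meixnerNorm θ a j * (w j * z j)) (by
    refine lt_of_le_of_lt (sum_le_sum fun j _ => ?_) hr.norm
    rw [abs_mul, abs_mul, sq]
    gcongr
    · exact (hw j).le
    · exact (hz j).le)
  have hinj : Function.Injective fun n : Fin d → ℕ => (n, n) := fun m n h => congrArg Prod.fst h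
  rw [← hinj.hasSum_iff]
  · refine h1.congr_fun fun n => ?_
    simp only [Function.comp, if_true, mul_pow, prod_mul_distrib]
    ring
  · rintro ⟨m, n⟩ hmn
    rw [if_neg, zero_mul]
    rintro (rfl : m = n)
    exact hmn ⟨m, rfl⟩

lemma tsum_meixnerWeight_mul (hα : 0 < α) (hθ : 0 < θ) (hp : ∀ i, 0 < p i)
    (hpsum : ∑ i, p i = 1) (hu0 : ∀ i, u 0 i = 1)
    (horth : ∀ k l, ∑ i, u k i * u l i * p i = if k = l then a k else 0)
    {M : (Fin d → ℕ) → (Fin d → ℕ) → ℝ}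
    (hgen : ∀ (x : Fin d → ℕ) (w : Fin d → ℝ), |w 0| < 1 →
      HasSum (fun n => M n x * ∏ j, w j ^ n j) (meixnerGenFun α θ u x w)) (m n : Fin d → ℕ) :
    ∑' x, meixnerWeight α θ p x * (M m x * M n x)
      = if m = n then negMultinomialCoeff α n * ∏ j, meixnerNorm θ a j ^ n j else 0 := by
  obtain ⟨r, hr⟩ := exists_isSmallRadius hθ u a
  have hr0 := hr.pos
  have hr1 : 0 < 1 - r := by linarith [hr.lt_one]
  have hC := meixnerSlope_pos (u := u) hθ
  choose S hS hSum using fun x =>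
    meixnerGenFun_expansion_bound hα hθ (hgen x) hr.pos hr.lt_one
  have hS0 : ∀ x, 0 ≤ S x := fun x => (hSum x).nonneg fun n => by positivity
  have hW := meixnerWeight_nonneg (p := p) hα hθ hp
  have hWS : Summable fun x => meixnerWeight α θ p x * (S x * S x) := by
    have h1 := (hasSum_meixnerWeight_mul_pow (p := p) hα hθ _ (sum_abs_ratio_lt_one hθ hp hpsum hr
      (c := fun _ => ((1 + meixnerSlope θ u * r) / (1 - r)) ^ 2)
      (fun i => (abs_of_nonneg (by positivity)).le))).summable.mul_left
      ((1 - r) ^ (-α) * (1 - r) ^ (-α))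
    refine Summable.of_nonneg_of_le
      (fun x => mul_nonneg (hW x) (mul_nonneg (hS0 x) (hS0 x))) (fun x => ?_) h1
    refine (mul_le_mul_of_nonneg_left (mul_le_mul (hS x) (hS x) (hS0 x) (by positivity))
      (hW x)).trans (le_of_eq ?_)
    rw [prod_pow_eq_pow_sum, ← pow_mul, mul_comm 2, pow_mul, sq]
    ring
  refine eq_of_hasSum_prod (c := fun m n => ∑' x, meixnerWeight α θ p x * (M m x * M n x))
    (c' := fun m n => if m = n then negMultinomialCoeff α n * ∏ j, meixnerNorm θ a j ^ n j else 0)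
    hr.pos (fun w z hw hz => ?_) (fun w z hw hz => hasSum_diagonal hα hr hw hz) m n
  have hle : ∀ v : Fin d → ℝ, (∀ i, |v i| < r) → ∀ n x,
      |M n x * ∏ j, v j ^ n j| ≤ |M n x| * ∏ j, r ^ n j := by
    intro v hv n x
    rw [abs_mul, abs_prod]
    gcongr with i
    rw [abs_pow]
    gcongr
    exact (hv i).le
  have key := hasSum_tsum_mul hW (hle w hw) (hle z hz) hSum hWS
    (fun x => hgen x w ((hw 0).trans hr.lt_one)) (fun x => hgen x z ((hz 0).trans hr.lt_one))
    (hasSum_meixnerWeight_mul_genFun hα hθ hp hpsum hu0 horth hr hw hz)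
  refine key.congr_fun fun q => ?_
  rw [← tsum_mul_right]
  exact tsum_congr fun x => by ring

lemma prod_meixnerNorm_pow (n : Fin d → ℕ) :
    ∏ j, meixnerNorm θ a j ^ n j = ((1 + θ) / θ) ^ n 0 * θ ^ ((∑ j, n j) - n 0)
      * ∏ j ∈ univ.erase 0, a j ^ n j := by
  have h1 : ∏ j ∈ univ.erase 0, meixnerNorm θ a j ^ n j
      = ∏ j ∈ univ.erase 0, (θ ^ n j * a j ^ n j) :=
    prod_congr rfl fun j hj => by rw [meixnerNorm, if_neg (ne_of_mem_erase hj), mul_pow]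
  rw [← mul_prod_erase _ _ (mem_univ (0 : Fin d)), ← add_sum_erase _ _ (mem_univ (0 : Fin d)),
    Nat.add_sub_cancel_left, h1, prod_mul_distrib, prod_pow_eq_pow_sum, meixnerNorm, if_pos rfl]
  ring

end Meixner

/-- Orthogonality of the multivariate Meixner polynomials `M_n(X;α,θ,p,u)`,
defined as coefficients of `w_0^{n_0}⋯w_{d-1}^{n_{d-1}}` in
`(1-w_0)^{-(|X|+α)} Π_i (1 - w_0(1+θ)/θ + Σ_{j≥1} u_i^{(j)} w_j)^{X_i}`,
with respect to the multivariate Meixner distribution: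
`E[M_m M_n] = δ_{mn} Γ(|n|+α)/(Γ(α) n_0!⋯n_{d-1}!) ((1+θ)/θ)^{n_0} θ^{|n|-n_0}
  Π_{j≥1} a_j^{n_j}`. -/
theorem multivariate_meixner_orthogonality
    (d : ℕ) [NeZero d] (α θ : ℝ) (hα : 0 < α) (hθ : 0 < θ)
    (p : Fin d → ℝ) (hp : ∀ i, 0 < p i) (hpsum : ∑ i, p i = 1)
    (a : Fin d → ℝ) (u : Fin d → Fin d → ℝ)
    (hu0 : ∀ i, u 0 i = 1)
    (horth : ∀ k l, ∑ i, u k i * u l i * p i = if k = l then a k else 0)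
    (M : (Fin d → ℕ) → (Fin d → ℕ) → ℝ)
    (hgen : ∀ (x : Fin d → ℕ) (w : Fin d → ℝ), |w 0| < 1 →
      HasSum (fun n : Fin d → ℕ => M n x * ∏ j, w j ^ n j)
        ((1 - w 0) ^ (-((∑ i, x i : ℝ) + α))
          * ∏ i, (1 - w 0 * (1 + θ) / θ
              + ∑ j ∈ Finset.univ.erase 0, u j i * w j) ^ x i)) :
    ∀ m n : Fin d → ℕ,
      (∑' x : Fin d → ℕ,
          Real.Gamma (α + ∑ i, x i) / (Real.Gamma α * (∑ i, x i).factorial)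
            * θ ^ (∑ i, x i) / (1 + θ) ^ (α + ∑ i, x i)
            * ((∑ i, x i).factorial / ∏ i, ((x i).factorial : ℝ))
            * (∏ i, p i ^ x i) * (M m x * M n x))
        = if m = n then
            Real.Gamma ((∑ j, n j : ℕ) + α)
              / (Real.Gamma α * ∏ j, ((n j).factorial : ℝ))
              * ((1 + θ) / θ) ^ n 0 * θ ^ ((∑ j, n j) - n 0)
              * ∏ j ∈ Finset.univ.erase 0, a j ^ n j
          else 0 := by
  intro m n
  simp only [meixnerWeight_eq hα hθ]
  rw [tsum_meixnerWeight_mul hα hθ hp hpsum hu0 horth hgen m n, prod_meixnerNorm_pow]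
  simp only [negMultinomialCoeff, mul_assoc]
end

section
/- The exponential transform of the multivariate Hermite polynomials is E[exp(Σ_i φ_i X_i) H_n(X;τ,u)] = exp(Σ_i τ_i φ_i²/2)·Π_{j=0}^{d-1}(Σ_{i=1}^d τ_i u_i^{(j)} φ_i)^{n_j}, where X has independent N(0,τ_i) components. -/
open MeasureTheory

open Polynomial in
/-- The probabilists' Hermite polynomial of degree `m` with variance parameter `s`. -/
noncomputable def hermiteVar (s : ℝ) : ℕ → ℝ[X]
  | 0 => 1
  | m + 1 => X * hermiteVar s m - C s * derivative (hermiteVar s m)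

theorem iteratedDeriv_exp_mul_sub_sq (s y : ℝ) (m : ℕ) :
    iteratedDeriv m (fun z : ℝ => Real.exp (y * z - s * z ^ 2 / 2))
      = fun z => (hermiteVar s m).eval (y - s * z) * Real.exp (y * z - s * z ^ 2 / 2) := by
  induction m with
  | zero => ext z; simp [hermiteVar]
  | succ m ih =>
    rw [iteratedDeriv_succ, ih]
    ext z
    have hlin : HasDerivAt (fun z : ℝ => y - s * z) (-s) z := by
      simpa using ((hasDerivAt_id z).const_mul s).const_sub y
    have hquad : HasDerivAt (fun z : ℝ => y * z - s * z ^ 2 / 2) (y - s * z) z := by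
      have h := ((hasDerivAt_id z).const_mul y).sub
        ((((hasDerivAt_id z).pow 2).const_mul s).div_const 2)
      refine h.congr_deriv ?_
      simp only [id]
      ring
    have h := (((hermiteVar s m).hasDerivAt (y - s * z)).comp z hlin).mul hquad.exp
    refine h.deriv.trans ?_
    simp only [hermiteVar, Function.comp_apply, Polynomial.eval_sub, Polynomial.eval_mul,
      Polynomial.eval_X, Polynomial.eval_C]
    ring

/-- A sequence with the Hermite generating function is the sequence of Hermite polynomials. -/
theorem eq_eval_hermiteVar_of_hasSum {s y : ℝ} {h : ℕ → ℝ}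
    (hgen : ∀ z : ℝ, HasSum (fun m : ℕ => h m * z ^ m / m.factorial)
      (Real.exp (y * z - s * z ^ 2 / 2))) (m : ℕ) :
    h m = (hermiteVar s m).eval y := by
  have hp : HasFPowerSeriesAt (fun z : ℝ => Real.exp (y * z - s * z ^ 2 / 2))
      (FormalMultilinearSeries.ofScalars ℝ fun m => h m / m.factorial) 0 := by
    rw [hasFPowerSeriesAt_iff]
    refine Filter.Eventually.of_forall fun z => ?_
    simp only [FormalMultilinearSeries.coeff_ofScalars, zero_add, smul_eq_mul]
    have hterm : ∀ k : ℕ, z ^ k * (h k / k.factorial) = h k * z ^ k / k.factorial :=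
      fun k => by ring
    simpa only [hterm] using hgen z
  obtain ⟨r, hr⟩ := hp
  have hm := hr.factorial_smul 1 m
  rw [← iteratedDeriv_eq_iteratedFDeriv, iteratedDeriv_exp_mul_sub_sq] at hm
  have hf : (m.factorial : ℝ) ≠ 0 := by positivity
  simpa [FormalMultilinearSeries.apply_eq_prod_smul_coeff,
    FormalMultilinearSeries.coeff_ofScalars, mul_div_cancel₀ _ hf] using hm

theorem integrable_gaussianPDFReal_mul_eval (μ : ℝ) {v : NNReal} (hv : v ≠ 0)
    (p : Polynomial ℝ) :
    Integrable fun x => ProbabilityTheory.gaussianPDFReal μ v x * p.eval x := by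
  have hint : Integrable (fun x => p.eval x) (ProbabilityTheory.gaussianReal μ v) := by
    simp_rw [Polynomial.eval_eq_sum_range]
    refine integrable_finsetSum _ fun k _ => Integrable.const_mul ?_ _
    have h := (ProbabilityTheory.memLp_id_gaussianReal (μ := μ) (v := v) k).integrable_norm_pow'
    refine h.mono' (by fun_prop) (.of_forall fun x => by simp)
  rw [ProbabilityTheory.gaussianReal_of_var_ne_zero _ hv,
    integrable_withDensity_iff_integrable_smul' (by fun_prop)
      (.of_forall fun _ => ProbabilityTheory.gaussianPDF_lt_top)] at hint
  simpa using hint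

theorem hasDerivAt_gaussianPDFReal (μ : ℝ) {v : NNReal} (hv : v ≠ 0) (x : ℝ) :
    HasDerivAt (ProbabilityTheory.gaussianPDFReal μ v)
      (-((x - μ) / v) * ProbabilityTheory.gaussianPDFReal μ v x) x := by
  have hv' : (v : ℝ) ≠ 0 := by exact_mod_cast hv
  have h := ((((((hasDerivAt_id x).sub_const μ).pow 2).neg).div_const (2 * (v : ℝ))).exp).const_mul
    (√(2 * Real.pi * v))⁻¹
  refine h.congr_deriv ?_
  simp only [ProbabilityTheory.gaussianPDFReal, id, Pi.pow_apply, Pi.neg_apply]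
  field_simp
  simp

theorem integral_gaussianPDFReal_mul_hermiteVar (μ : ℝ) {v : NNReal} (hv : v ≠ 0) (m : ℕ) :
    ∫ x, ProbabilityTheory.gaussianPDFReal μ v x * (hermiteVar v m).eval x = μ ^ m := by
  have hv' : (v : ℝ) ≠ 0 := by exact_mod_cast hv
  induction m with
  | zero => simp [hermiteVar, ProbabilityTheory.integral_gaussianPDFReal_eq_one μ hv]
  | succ m ih =>
    set P := hermiteVar v m
    have hI := integrable_gaussianPDFReal_mul_eval μ hv
    have hzero := integral_eq_zero_of_hasDerivAt_of_integrable
      (f := fun x => ProbabilityTheory.gaussianPDFReal μ v x * (-(v : ℝ) * P.eval x))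
      (f' := fun x => ProbabilityTheory.gaussianPDFReal μ v x * (hermiteVar v (m + 1)).eval x
        - μ * (ProbabilityTheory.gaussianPDFReal μ v x * P.eval x))
      (fun x => by
        refine ((hasDerivAt_gaussianPDFReal μ hv x).mul
          ((P.hasDerivAt x).const_mul (-(v : ℝ)))).congr_deriv ?_
        simp only [hermiteVar, Polynomial.eval_sub, Polynomial.eval_mul,
          Polynomial.eval_X, Polynomial.eval_C, P]
        field_simp
        ring)
      ((hI _).sub ((hI _).const_mul _))
      (by simpa [mul_left_comm] using (hI P).const_mul (-(v : ℝ)))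
    rw [integral_sub (hI _) ((hI _).const_mul _), integral_const_mul, ih] at hzero
    rw [pow_succ']
    linarith

open Matrix in
/-- If `M` diagonalizes the covariance `diag τ` to `diag σ`, then it carries the associated
inverse quadratic forms to each other. -/
theorem sum_mulVec_sq_div {ι : Type*} [Fintype ι] [DecidableEq ι] {M : Matrix ι ι ℝ}
    {τ σ : ι → ℝ} (hτ : ∀ i, 0 < τ i) (hσ : ∀ i, 0 < σ i)
    (hM : M * diagonal τ * Mᵀ = diagonal σ) (w : ι → ℝ) :
    ∑ j, (M *ᵥ w) j ^ 2 / σ j = ∑ i, w i ^ 2 / τ i := by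
  have hright : M * (diagonal τ * Mᵀ * diagonal fun j => (σ j)⁻¹) = 1 := by
    rw [← Matrix.mul_assoc, ← Matrix.mul_assoc, hM, diagonal_mul_diagonal, ← diagonal_one]
    congr 1
    ext j
    exact mul_inv_cancel₀ (hσ j).ne'
  have hleft : ∀ i, τ i * ∑ j, M j i * ((σ j)⁻¹ * (M *ᵥ w) j) = w i := by
    intro i
    have h := congrFun (congrArg (· *ᵥ w) (mul_eq_one_comm.mp hright)) i
    simp only [← mulVec_mulVec, one_mulVec] at h
    rw [mulVec_diagonal] at h
    simpa [mulVec, dotProduct, diagonal_apply, transpose_apply] using h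
  calc ∑ j, (M *ᵥ w) j ^ 2 / σ j
      = ∑ j, ∑ i, M j i * w i * ((σ j)⁻¹ * (M *ᵥ w) j) := by
        refine Finset.sum_congr rfl fun j _ => ?_
        rw [← Finset.sum_mul]
        simp only [mulVec, dotProduct]
        ring
    _ = ∑ i, w i * ∑ j, M j i * ((σ j)⁻¹ * (M *ᵥ w) j) := by
        rw [Finset.sum_comm]
        simp only [Finset.mul_sum]
        refine Finset.sum_congr rfl fun i _ => Finset.sum_congr rfl fun j _ => by ring
    _ = ∑ i, w i ^ 2 / τ i := by
        refine Finset.sum_congr rfl fun i _ => ?_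
        rw [eq_div_iff (hτ i).ne', sq]
        conv_rhs => rw [← hleft i]
        rw [hleft i]
        linear_combination w i * hleft i

open Matrix in
theorem det_sq_mul_prod_of_mul_diagonal_mul_transpose {ι : Type*} [Fintype ι] [DecidableEq ι]
    {M : Matrix ι ι ℝ} {τ σ : ι → ℝ} (hM : M * diagonal τ * Mᵀ = diagonal σ) :
    M.det ^ 2 * ∏ i, τ i = ∏ i, σ i := by
  have h := congrArg det hM
  simp only [det_mul, det_diagonal, det_transpose] at h
  linarith

open Matrix in
theorem integral_comp_mulVec {ι : Type*} [Fintype ι] [DecidableEq ι] {M : Matrix ι ι ℝ}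
    (hM : M.det ≠ 0) (g : (ι → ℝ) → ℝ) :
    ∫ x, g (M *ᵥ x) = |M.det|⁻¹ * ∫ y, g y := by
  have hemb : MeasurableEmbedding (toLin' M) :=
    (LinearMap.continuous_on_pi (toLin' M)).measurableEmbedding
      (mulVec_injective_of_isUnit ((isUnit_iff_isUnit_det M).mpr hM.isUnit))
  have h := hemb.integral_map (μ := volume) g
  rw [Real.map_matrix_volume_pi_eq_smul_volume_pi hM, integral_smul_measure,
    ENNReal.toReal_ofReal (abs_nonneg _), abs_inv, smul_eq_mul] at h
  exact h.symm

open Matrix ProbabilityTheory in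
/-- A linear map diagonalizing the covariance carries a Gaussian density with independent
components to another one. -/
theorem prod_gaussianPDFReal_eq_abs_det_mul {ι : Type*} [Fintype ι] [DecidableEq ι]
    {M : Matrix ι ι ℝ} {τ σ : ι → NNReal} (hτ : ∀ i, 0 < τ i) (hσ : ∀ i, 0 < σ i)
    (hM : M * diagonal (fun i => (τ i : ℝ)) * Mᵀ = diagonal fun i => (σ i : ℝ)) (μ x : ι → ℝ) :
    ∏ i, gaussianPDFReal (μ i) (τ i) (x i)
      = |M.det| * ∏ j, gaussianPDFReal ((M *ᵥ μ) j) (σ j) ((M *ᵥ x) j) := by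
  have hdet := det_sq_mul_prod_of_mul_diagonal_mul_transpose hM
  have hτ' : 0 < ∏ i, √(2 * Real.pi * τ i) :=
    Finset.prod_pos fun i _ => Real.sqrt_pos.mpr (by have := hτ i; positivity)
  have hσ' : 0 < ∏ i, √(2 * Real.pi * σ i) :=
    Finset.prod_pos fun i _ => Real.sqrt_pos.mpr (by have := hσ i; positivity)
  have hconst : |M.det| * ∏ i, √(2 * Real.pi * τ i) = ∏ i, √(2 * Real.pi * σ i) := by
    rw [← sq_eq_sq₀ (by positivity) hσ'.le, mul_pow, sq_abs, ← Finset.prod_pow, ← Finset.prod_pow]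
    have hsq : ∀ t : NNReal, √(2 * Real.pi * t) ^ 2 = 2 * Real.pi * t :=
      fun t => Real.sq_sqrt (by positivity)
    simp only [hsq, Finset.prod_mul_distrib, ← hdet]
    ring
  have hquad := sum_mulVec_sq_div (fun i => NNReal.coe_pos.mpr (hτ i))
    (fun i => NNReal.coe_pos.mpr (hσ i)) hM (x - μ)
  have hexp : ∑ i, -(x i - μ i) ^ 2 / (2 * (τ i : ℝ))
      = ∑ j, -((M *ᵥ x) j - (M *ᵥ μ) j) ^ 2 / (2 * (σ j : ℝ)) := by
    simp only [mulVec_sub, Pi.sub_apply] at hquad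
    have hhalf : ∀ b c : ℝ, -b ^ 2 / (2 * c) = -(1 / 2) * (b ^ 2 / c) := by
      intro b c
      rw [mul_comm 2 c, ← div_div]
      ring
    simp only [hhalf, ← Finset.mul_sum, hquad]
  simp only [gaussianPDFReal, Finset.prod_mul_distrib, Finset.prod_inv_distrib,
    ← Real.exp_sum, ← hexp]
  rw [← hconst, mul_inv]
  have : |M.det| ≠ 0 := fun h => hσ'.ne (by rw [← hconst, h, zero_mul])
  field_simp

theorem gaussianPDFReal_zero_mul_exp {v : NNReal} (hv : v ≠ 0) (φ x : ℝ) :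
    ProbabilityTheory.gaussianPDFReal 0 v x * Real.exp (φ * x)
      = Real.exp (v * φ ^ 2 / 2) * ProbabilityTheory.gaussianPDFReal (v * φ) v x := by
  have hv' : (v : ℝ) ≠ 0 := by exact_mod_cast hv
  simp only [ProbabilityTheory.gaussianPDFReal]
  rw [mul_assoc, mul_left_comm (Real.exp _), ← Real.exp_add, ← Real.exp_add]
  congr 2
  field_simp
  ring

/-- Exponential transform of the multivariate Hermite polynomials:
`E[exp(Σ_i φ_i X_i) H_n(X;τ,u)]
  = exp(Σ_i τ_i φ_i²/2) Π_j (Σ_i τ_i u_i^{(j)} φ_i)^{n_j}`,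
where `H_n(x;τ,u) = Π_j H_{n_j}(\hat x_j; |τ| a_j)` and `X` has independent
`N(0,τ_i)` components. -/
theorem multivariate_hermite_transform
    (d : ℕ) [NeZero d] (τ : Fin d → ℝ) (hτ : ∀ i, 0 < τ i)
    (a : Fin d → ℝ) (ha : ∀ j, 0 < a j)
    (u : Fin d → Fin d → ℝ) (hu0 : ∀ i, u 0 i = 1)
    (horth : ∀ k l, ∑ i, u k i * u l i * (τ i / ∑ i', τ i')
      = if k = l then a k else 0)
    (H : ℕ → ℝ → ℝ → ℝ)
    (hgen : ∀ (σ2 y z : ℝ),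
      HasSum (fun m : ℕ => H m σ2 y * z ^ m / m.factorial)
        (Real.exp (y * z - σ2 * z ^ 2 / 2))) :
    ∀ (n : Fin d → ℕ) (φ : Fin d → ℝ),
      (∫ x : Fin d → ℝ,
          (∏ i, (Real.sqrt (2 * Real.pi * τ i))⁻¹
              * Real.exp (-(x i ^ 2) / (2 * τ i)))
            * Real.exp (∑ i, φ i * x i)
            * ∏ j, H (n j) ((∑ i', τ i') * a j) (∑ i, u j i * x i))
        = Real.exp (∑ i, τ i * φ i ^ 2 / 2)
            * ∏ j, (∑ i, τ i * u j i * φ i) ^ n j := by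
  intro n φ
  classical
  have hT : 0 < ∑ i, τ i := Finset.sum_pos (fun i _ => hτ i) ⟨0, Finset.mem_univ _⟩
  set T := ∑ i, τ i
  lift τ to Fin d → NNReal using fun i => (hτ i).le
  let M : Matrix (Fin d) (Fin d) ℝ := Matrix.of u
  let σ : Fin d → NNReal := fun j => ⟨T * a j, (mul_pos hT (ha j)).le⟩
  have hτ' : ∀ i, 0 < τ i := fun i => NNReal.coe_pos.mp (hτ i)
  have hσ : ∀ j, 0 < σ j := fun j => NNReal.coe_pos.mp (mul_pos hT (ha j))
  have hM : M * Matrix.diagonal (fun i => (τ i : ℝ)) * M.transpose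
      = Matrix.diagonal fun j => (σ j : ℝ) := by
    ext k l
    have h : ∑ i, u k i * τ i * u l i = T * if k = l then a k else 0 := by
      rw [← horth k l, Finset.mul_sum]
      refine Finset.sum_congr rfl fun i _ => ?_
      field_simp
    rw [Matrix.mul_apply, Matrix.diagonal_apply]
    simp only [Matrix.mul_diagonal, Matrix.transpose_apply, M, Matrix.of_apply, h]
    rw [mul_ite, mul_zero]
    rfl
  have hdet : M.det ≠ 0 := by
    intro h
    have h' := det_sq_mul_prod_of_mul_diagonal_mul_transpose hM
    rw [h, zero_pow two_ne_zero, zero_mul] at h'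
    exact (Finset.prod_pos fun j _ => NNReal.coe_pos.mpr (hσ j)).ne h'
  have hH : ∀ m j y, H m (T * a j) y = (hermiteVar (σ j) m).eval y := fun m j y =>
    eq_eval_hermiteVar_of_hasSum (fun z => hgen (T * a j) y z) m
  set μ : Fin d → ℝ := fun i => τ i * φ i
  have hpoint : ∀ x : Fin d → ℝ,
      (∏ i, (√(2 * Real.pi * τ i))⁻¹ * Real.exp (-(x i ^ 2) / (2 * τ i)))
          * Real.exp (∑ i, φ i * x i) * ∏ j, H (n j) (T * a j) (∑ i, u j i * x i)
        = Real.exp (∑ i, τ i * φ i ^ 2 / 2) * (|M.det| *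
          ∏ j, ProbabilityTheory.gaussianPDFReal (M.mulVec μ j) (σ j) (M.mulVec x j)
            * (hermiteVar (σ j) (n j)).eval (M.mulVec x j)) := by
    intro x
    have hshift : (∏ i, (√(2 * Real.pi * τ i))⁻¹ * Real.exp (-(x i ^ 2) / (2 * τ i)))
          * Real.exp (∑ i, φ i * x i)
        = Real.exp (∑ i, τ i * φ i ^ 2 / 2)
          * ∏ i, ProbabilityTheory.gaussianPDFReal (μ i) (τ i) (x i) := by
      rw [Real.exp_sum, Real.exp_sum, ← Finset.prod_mul_distrib, ← Finset.prod_mul_distrib]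
      refine Finset.prod_congr rfl fun i _ => ?_
      rw [← gaussianPDFReal_zero_mul_exp (hτ' i).ne', ProbabilityTheory.gaussianPDFReal, sub_zero]
    rw [hshift, prod_gaussianPDFReal_eq_abs_det_mul hτ' hσ hM, Finset.prod_mul_distrib]
    simp only [hH, mul_assoc]
    rfl
  simp_rw [hpoint]
  rw [integral_const_mul, integral_const_mul, integral_comp_mulVec hdet fun y => ∏ j,
      ProbabilityTheory.gaussianPDFReal (M.mulVec μ j) (σ j) (y j)
        * (hermiteVar (σ j) (n j)).eval (y j),
    mul_inv_cancel_left₀ (abs_ne_zero.mpr hdet), integral_fintype_prod_volume_eq_prod fun j y =>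
      ProbabilityTheory.gaussianPDFReal (M.mulVec μ j) (σ j) y
        * (hermiteVar (σ j) (n j)).eval y]
  congr 1
  refine Finset.prod_congr rfl fun j _ => ?_
  rw [integral_gaussianPDFReal_mul_hermiteVar _ (hσ j).ne']
  congr 1
  rw [Matrix.mulVec, dotProduct]
  refine Finset.sum_congr rfl fun i _ => ?_
  simp only [M, μ, Matrix.of_apply]
  ring
end
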